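/- arXiv:2103.05246 — 3 statements merged into one kernel-verified Lean document; each statement's English description precedes it below -/
import Mathlib

section
/- If qⱼ ≥ 0 for every 1 ≤ j ≤ k, then there is a constant N (depending only on the dimension d, namely the Besicovitch covering constant of ℝ^d) such that H^{q,1}_{μ,ν}(E) ≤ N for every set E ⊆ ℝ^d; in particular H^{q,1}_{μ,ν}(E) < ∞. -/
open MeasureTheory Metric Set Filter ENNReal Topology

noncomputable section

namespace MixedMultifractal

variable {X : Type*} [MetricSpace X] [MeasurableSpace X]

/-- `ℝ^d` as a Euclidean space. -/
abbrev Rd (d : ℕ) := EuclideanSpace ℝ (Fin d)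

/-- A centered `δ`-covering of `E`: a countable family of closed balls with centers in `E`
and radii in `(0, δ)` covering `E`. -/
def IsCenteredCover (E : Set X) (δ : ℝ) (I : Set (X × ℝ)) : Prop :=
  I.Countable ∧ (∀ p ∈ I, p.1 ∈ E ∧ 0 < p.2 ∧ p.2 < δ) ∧
    E ⊆ ⋃ p ∈ I, closedBall p.1 p.2

/-- A centered `δ`-packing of `E`: a countable family of pairwise disjoint closed balls
with centers in `E` and radii in `(0, δ)`. -/
def IsCenteredPacking (E : Set X) (δ : ℝ) (I : Set (X × ℝ)) : Prop :=
  I.Countable ∧ (∀ p ∈ I, p.1 ∈ E ∧ 0 < p.2 ∧ p.2 < δ) ∧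
    I.Pairwise fun p p' => Disjoint (closedBall p.1 p.2) (closedBall p'.1 p'.2)

/-- Pre-measure `H̄_δ` associated with a gauge `g` on balls (a ball is coded by its
center-radius pair). -/
def preH (g : X × ℝ → ℝ≥0∞) (δ : ℝ) (E : Set X) : ℝ≥0∞ :=
  ⨅ (I : Set (X × ℝ)) (_ : IsCenteredCover E δ I), ∑' p : I, g (p : X × ℝ)

/-- `H̄ = sup_{δ > 0} H̄_δ` (the limit as `δ ↓ 0`). -/
def barH (g : X × ℝ → ℝ≥0∞) (E : Set X) : ℝ≥0∞ :=
  ⨆ (δ : ℝ) (_ : 0 < δ), preH g δ E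

/-- The (generalized) multifractal Hausdorff measure: `H(E) = sup_{F ⊆ E} H̄(F)`. -/
def mixedH (g : X × ℝ → ℝ≥0∞) (E : Set X) : ℝ≥0∞ :=
  ⨆ (F : Set X) (_ : F ⊆ E), barH g F

/-- Pre-measure `P̄_δ` associated with a gauge `g` on balls. -/
def preP (g : X × ℝ → ℝ≥0∞) (δ : ℝ) (E : Set X) : ℝ≥0∞ :=
  ⨆ (I : Set (X × ℝ)) (_ : IsCenteredPacking E δ I), ∑' p : I, g (p : X × ℝ)

/-- `P̄ = inf_{δ > 0} P̄_δ` (the limit as `δ ↓ 0`). -/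
def barP (g : X × ℝ → ℝ≥0∞) (E : Set X) : ℝ≥0∞ :=
  ⨅ (δ : ℝ) (_ : 0 < δ), preP g δ E

/-- The (generalized) multifractal packing measure:
`P(E) = inf { Σ P̄(Eₙ) : E ⊆ ⋃ Eₙ }`. -/
def mixedP (g : X × ℝ → ℝ≥0∞) (E : Set X) : ℝ≥0∞ :=
  ⨅ (s : ℕ → Set X) (_ : E ⊆ ⋃ n, s n), ∑' n, barP g (s n)

/-- The mixed multifractal gauge `μ(B(x,r))^q · ν(B(x,r))^t` with
`μ(B)^q = ∏ⱼ μⱼ(B)^{qⱼ}` (here `^` is `ENNReal.rpow`, so `0 ^ s = ∞` for `s < 0` and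
`0 ^ 0 = 1`). -/
def mgauge {k : ℕ} (μ : Fin k → Measure X) (q : Fin k → ℝ) (ν : Measure X) (t : ℝ) :
    X × ℝ → ℝ≥0∞ :=
  fun p => (∏ j, μ j (closedBall p.1 p.2) ^ q j) * ν (closedBall p.1 p.2) ^ t

/-- The non-mixed multifractal gauge `μ(B(x,r))^q · (2r)^s`. -/
def sgauge {k : ℕ} (μ : Fin k → Measure X) (q : Fin k → ℝ) (s : ℝ) :
    X × ℝ → ℝ≥0∞ :=
  fun p => (∏ j, μ j (closedBall p.1 p.2) ^ q j) * ENNReal.ofReal (2 * p.2) ^ s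

/-- The topological support of a measure. -/
def msupport (σ : Measure X) : Set X :=
  {x : X | ∀ r : ℝ, 0 < r → 0 < σ (closedBall x r)}

/-- `S_μ = supp μ₁ ∩ … ∩ supp μ_k`. -/
def Smu {k : ℕ} (μ : Fin k → Measure X) : Set X := ⋂ j, msupport (μ j)

/-- A measure `σ` is doubling if for some `a > 1`,
`limsup_{r ↓ 0} sup_{x ∈ supp σ} σ(B(x,ar))/σ(B(x,r)) < ∞`. -/
def IsDoubling (σ : Measure X) : Prop :=
  ∃ a : ℝ, 1 < a ∧
    limsup (fun r : ℝ => ⨆ x ∈ msupport σ, σ (closedBall x (a * r)) / σ (closedBall x r))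
      (𝓝[>] (0 : ℝ)) < ⊤

/-- `ν` is quasi-Ahlfors regular with index `α`: `limsup_{|U| → 0} ν(U)/|U|^α < ∞`,
i.e. there are `M < ∞` and `δ > 0` with `ν(U) ≤ M · |U|^α` whenever `|U| < δ`. -/
def IsQuasiAhlfors (ν : Measure X) (α : ℝ) : Prop :=
  ∃ M : ℝ≥0∞, M ≠ ⊤ ∧ ∃ δ : ℝ, 0 < δ ∧
    ∀ U : Set X, EMetric.diam U < ENNReal.ofReal δ → ν U ≤ M * EMetric.diam U ^ α

/-- The upper `(q,t)`-density of `θ` at `x` relative to `(μ, ν)`. -/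
def upperDensity {k : ℕ} (μ : Fin k → Measure X) (q : Fin k → ℝ) (ν : Measure X) (t : ℝ)
    (θ : Measure X) (x : X) : ℝ≥0∞ :=
  limsup (fun r : ℝ => θ (closedBall x r) / mgauge μ q ν t (x, r)) (𝓝[>] (0 : ℝ))

/-- The lower `(q,t)`-density of `θ` at `x` relative to `(μ, ν)`. -/
def lowerDensity {k : ℕ} (μ : Fin k → Measure X) (q : Fin k → ℝ) (ν : Measure X) (t : ℝ)
    (θ : Measure X) (x : X) : ℝ≥0∞ :=
  liminf (fun r : ℝ => θ (closedBall x r) / mgauge μ q ν t (x, r)) (𝓝[>] (0 : ℝ))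

/-- The upper density at `x` of a set function `m` evaluated on `E ∩ B(x,r)`, relative to
the mixed gauge; used for `D̄` (with `m = H^{q,t}`) and `Δ̄` (with `m = P^{q,t}`). -/
def upperSetDensity {k : ℕ} (m : Set X → ℝ≥0∞) (μ : Fin k → Measure X) (q : Fin k → ℝ)
    (ν : Measure X) (t : ℝ) (E : Set X) (x : X) : ℝ≥0∞ :=
  limsup (fun r : ℝ => m (E ∩ closedBall x r) / mgauge μ q ν t (x, r)) (𝓝[>] (0 : ℝ))

/-- The lower density at `x` of a set function `m` evaluated on `E ∩ B(x,r)`; used for `D̲`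
and `Δ̲`. -/
def lowerSetDensity {k : ℕ} (m : Set X → ℝ≥0∞) (μ : Fin k → Measure X) (q : Fin k → ℝ)
    (ν : Measure X) (t : ℝ) (E : Set X) (x : X) : ℝ≥0∞ :=
  liminf (fun r : ℝ => m (E ∩ closedBall x r) / mgauge μ q ν t (x, r)) (𝓝[>] (0 : ℝ))

/-- The mixed multifractal Hausdorff dimension `dim^q_{μ,ν}`. -/
def mixedHDim {k : ℕ} (μ : Fin k → Measure X) (q : Fin k → ℝ) (ν : Measure X)
    (A : Set X) : ℝ :=
  sInf {s : ℝ | mixedH (mgauge μ q ν s) A = 0}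

/-- The mixed multifractal packing dimension `Dim^q_{μ,ν}`. -/
def mixedPDim {k : ℕ} (μ : Fin k → Measure X) (q : Fin k → ℝ) (ν : Measure X)
    (A : Set X) : ℝ :=
  sInf {s : ℝ | mixedP (mgauge μ q ν s) A = 0}

/-- Carathéodory measurability of `F` with respect to a set function `m`. -/
def CaratheodoryMeasurable (m : Set X → ℝ≥0∞) (F : Set X) : Prop :=
  ∀ A : Set X, m A = m (A ∩ F) + m (A \ F)

/-- `D̄^{q,t}_{μ,ν}(x, A)`: upper density of the mixed Hausdorff measure of `A` near `x`. -/
def DUpper {k : ℕ} (μ : Fin k → Measure X) (q : Fin k → ℝ) (ν : Measure X) (t : ℝ)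
    (A : Set X) (x : X) : ℝ≥0∞ :=
  upperSetDensity (mixedH (mgauge μ q ν t)) μ q ν t A x

/-- `D̲^{q,t}_{μ,ν}(x, A)`: lower density of the mixed Hausdorff measure of `A` near `x`. -/
def DLower {k : ℕ} (μ : Fin k → Measure X) (q : Fin k → ℝ) (ν : Measure X) (t : ℝ)
    (A : Set X) (x : X) : ℝ≥0∞ :=
  lowerSetDensity (mixedH (mgauge μ q ν t)) μ q ν t A x

/-- `Δ̄^{q,t}_{μ,ν}(x, A)`: upper density of the mixed packing measure of `A` near `x`. -/
def DeltaUpper {k : ℕ} (μ : Fin k → Measure X) (q : Fin k → ℝ) (ν : Measure X) (t : ℝ)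
    (A : Set X) (x : X) : ℝ≥0∞ :=
  upperSetDensity (mixedP (mgauge μ q ν t)) μ q ν t A x

/-- `Δ̲^{q,t}_{μ,ν}(x, A)`: lower density of the mixed packing measure of `A` near `x`. -/
def DeltaLower {k : ℕ} (μ : Fin k → Measure X) (q : Fin k → ℝ) (ν : Measure X) (t : ℝ)
    (A : Set X) (x : X) : ℝ≥0∞ :=
  lowerSetDensity (mixedP (mgauge μ q ν t)) μ q ν t A x

/-- For nonnegative exponents and probability measures, the mixed gauge with `t = 1` is dominated
by the measure of the ball. -/
lemma mgauge_one_le {k : ℕ} (μ : Fin k → Measure X) (q : Fin k → ℝ) (ν : Measure X)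
    (hμ : ∀ j, IsProbabilityMeasure (μ j)) (hq : ∀ j, 0 ≤ q j) (p : X × ℝ) :
    mgauge μ q ν 1 p ≤ ν (closedBall p.1 p.2) := by
  have hprod : ∏ j, μ j (closedBall p.1 p.2) ^ q j ≤ 1 :=
    Finset.prod_le_one' fun j _ => ENNReal.rpow_le_one prob_le_one (hq j)
  calc mgauge μ q ν 1 p
      = (∏ j, μ j (closedBall p.1 p.2) ^ q j) * ν (closedBall p.1 p.2) := by
        simp [mgauge]
    _ ≤ 1 * ν (closedBall p.1 p.2) := by gcongr
    _ = ν (closedBall p.1 p.2) := one_mul _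

/-- If there is no satellite configuration with `N + 1` points, then any gauge dominated by a
measure `ν` on balls has pre-measure at most `N * ν univ`. -/
lemma preH_le_of_isEmpty_satelliteConfig [SecondCountableTopology X] [OpensMeasurableSpace X]
    {N : ℕ} {τ : ℝ} (hτ : 1 < τ) (hN : IsEmpty (Besicovitch.SatelliteConfig X N τ))
    {g : X × ℝ → ℝ≥0∞} {ν : Measure X} (hg : ∀ p, g p ≤ ν (closedBall p.1 p.2))
    {δ : ℝ} (hδ : 0 < δ) (F : Set X) :
    preH g δ F ≤ N * ν univ := by
  have hr : 0 < δ / 2 := half_pos hδ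
  let b : Besicovitch.BallPackage F X :=
    { c := Subtype.val
      r := fun _ => δ / 2
      rpos := fun _ => hr
      r_bound := δ / 2
      r_le := fun _ => le_rfl }
  obtain ⟨s, hdisj, hcov⟩ := Besicovitch.exist_disjoint_covering_families hτ hN b
  have hcount (i : Fin N) : (s i).Countable :=
    (hdisj i).countable_of_nonempty_interior fun j _ =>
      ⟨(j : X), ball_subset_interior_closedBall (mem_ball_self hr)⟩
  let e : F → X × ℝ := fun x => ((x : X), δ / 2)
  have he : Function.Injective e := fun x y h => Subtype.ext (Prod.ext_iff.1 h).1
  have hI : IsCenteredCover F δ (⋃ i, e '' s i) := by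
    refine ⟨countable_iUnion fun i => (hcount i).image e, ?_, ?_⟩
    · intro p hp
      obtain ⟨i, x, -, rfl⟩ := mem_iUnion.1 hp
      exact ⟨x.2, hr, half_lt_self hδ⟩
    · intro x hx
      obtain ⟨i, hi⟩ := mem_iUnion.1 (hcov ⟨⟨x, hx⟩, rfl⟩)
      obtain ⟨j, hj, hxj⟩ := mem_iUnion₂.1 hi
      exact mem_iUnion₂.2 ⟨e j, mem_iUnion.2 ⟨i, j, hj, rfl⟩, ball_subset_closedBall hxj⟩
  have hfamily (i : Fin N) : ∑' p : e '' s i, g p ≤ ν univ := by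
    rw [tsum_image g he.injOn]
    calc ∑' x : s i, g (e x)
        ≤ ∑' x : s i, ν (closedBall (x : X) (δ / 2)) := ENNReal.tsum_le_tsum fun x => hg _
      _ = ν (⋃ x ∈ s i, closedBall (x : X) (δ / 2)) :=
        (measure_biUnion (hcount i) (hdisj i) fun _ _ => measurableSet_closedBall).symm
      _ ≤ ν univ := measure_mono (subset_univ _)
  calc preH g δ F
      ≤ ∑' p : ↥(⋃ i, e '' s i), g p := iInf₂_le _ hI
    _ ≤ ∑ i, ∑' p : e '' s i, g p := ENNReal.tsum_iUnion_le g _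
    _ ≤ ∑ _i : Fin N, ν univ := Finset.sum_le_sum fun i _ => hfamily i
    _ = N * ν univ := by simp

/-- if all the `qⱼ` are nonnegative then `H^{q,1}_{μ,ν}(E)` is bounded
by a constant `N < ∞` depending only on the dimension `d` (the Besicovitch constant). -/
theorem mixedH_at_one_le_besicovitch_const
    (d : ℕ) (hd : 1 ≤ d) :
    ∃ N : ℝ≥0∞, N < ⊤ ∧
      ∀ (k : ℕ), 1 ≤ k →
        ∀ (μ : Fin k → Measure (Rd d)) (ν : Measure (Rd d)),
          (∀ j, IsProbabilityMeasure (μ j)) → IsProbabilityMeasure ν →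
            ∀ q : Fin k → ℝ, (∀ j, 0 ≤ q j) →
              ∀ E : Set (Rd d), mixedH (mgauge μ q ν 1) E ≤ N := by
  refine ⟨(Besicovitch.multiplicity (Rd d) : ℝ≥0∞), ENNReal.natCast_lt_top _, ?_⟩
  intro k _ μ ν hμ hν q hq E
  refine iSup₂_le fun F _ => iSup₂_le fun δ hδ => ?_
  simpa using preH_le_of_isEmpty_satelliteConfig (Besicovitch.one_lt_goodτ (Rd d))
    (Besicovitch.isEmpty_satelliteConfig_multiplicity (Rd d)) (mgauge_one_le μ q ν hμ hq) hδ F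

end MixedMultifractal
end
end

section
/- Let E ⊆ S_μ ∩ S_ν be a Borel set with 0 < P^{q,t}_{μ,ν}(E) < ∞, and suppose each μⱼ and ν are doubling. Then the following are equivalent: (a) H^{q,t}_{μ,ν}(F) = P^{q,t}_{μ,ν}(F) for every Borel set F ⊆ E; (b) D̄^{q,t}_{μ,ν}(x,E) = D̲^{q,t}_{μ,ν}(x,E) = 1 for P^{q,t}_{μ,ν}-almost every x ∈ E; (c) Δ̄^{q,t}_{μ,ν}(x,E) = Δ̲^{q,t}_{μ,ν}(x,E) = 1 for P^{q,t}_{μ,ν}-almost every x ∈ E. -/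
open MeasureTheory Metric Set Filter ENNReal Topology

noncomputable section

namespace MixedMultifractal

variable {X : Type*} [MetricSpace X] [MeasurableSpace X]

section OuterMeasures

variable {Y : Type*} [MetricSpace Y] {g : Y × ℝ → ℝ≥0∞}

lemma preH_anti {δ δ' : ℝ} (h : δ ≤ δ') (A : Set Y) : preH g δ' A ≤ preH g δ A :=
  le_iInf₂ fun I hI => iInf₂_le I
    ⟨hI.1, fun p hp => ⟨(hI.2.1 p hp).1, (hI.2.1 p hp).2.1, (hI.2.1 p hp).2.2.trans_le h⟩, hI.2.2⟩

lemma IsCenteredPacking.tsum_le_preP {δ : ℝ} {A : Set Y} {I : Set (Y × ℝ)}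
    (hI : IsCenteredPacking A δ I) : ∑' p : I, g p ≤ preP g δ A :=
  le_iSup₂ (f := fun I (_ : IsCenteredPacking A δ I) => ∑' p : I, g p) I hI

lemma IsCenteredPacking.mono {δ δ' : ℝ} (h : δ ≤ δ') {A A' : Set Y} (hA : A ⊆ A')
    {I : Set (Y × ℝ)} (hI : IsCenteredPacking A δ I) : IsCenteredPacking A' δ' I :=
  ⟨hI.1, fun p hp => ⟨hA (hI.2.1 p hp).1, (hI.2.1 p hp).2.1, (hI.2.1 p hp).2.2.trans_le h⟩,
    hI.2.2⟩

lemma preP_mono {δ δ' : ℝ} (h : δ ≤ δ') {A A' : Set Y} (hA : A ⊆ A') :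
    preP g δ A ≤ preP g δ' A' :=
  iSup₂_le fun _ hI => (hI.mono h hA).tsum_le_preP

lemma barP_mono {A A' : Set Y} (hA : A ⊆ A') : barP g A ≤ barP g A' :=
  iInf₂_mono fun _ _ => preP_mono le_rfl hA

lemma mixedH_mono {A A' : Set Y} (hA : A ⊆ A') : mixedH g A ≤ mixedH g A' :=
  iSup₂_le fun F hF => le_iSup₂ (f := fun F (_ : F ⊆ A') => barH g F) F (hF.trans hA)

lemma barH_le_mixedH (A : Set Y) : barH g A ≤ mixedH g A :=
  le_iSup₂ (f := fun F (_ : F ⊆ A) => barH g F) A Subset.rfl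

lemma preH_le_barH {δ : ℝ} (hδ : 0 < δ) (A : Set Y) : preH g δ A ≤ barH g A :=
  le_iSup₂ (f := fun δ (_ : 0 < δ) => preH g δ A) δ hδ

lemma barH_empty : barH g (∅ : Set Y) = 0 := by
  refine le_antisymm (iSup₂_le fun δ _ => ?_) zero_le
  refine (iInf₂_le ∅ ⟨countable_empty, by simp, by simp⟩).trans ?_
  simp

lemma barP_empty : barP g (∅ : Set Y) = 0 := by
  refine le_antisymm ((iInf₂_le 1 one_pos).trans (iSup₂_le fun I hI => ?_)) zero_le
  have : I = ∅ := eq_empty_of_forall_notMem fun p hp => (hI.2.1 p hp).1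
  simp [this]

lemma preH_iUnion_le {δ : ℝ} {ι : Type*} [Countable ι] (A : ι → Set Y) :
    preH g δ (⋃ n, A n) ≤ ∑' n, preH g δ (A n) := by
  refine ENNReal.le_of_forall_pos_le_add fun ε hε hfin => ?_
  obtain ⟨ε', hε', hsum⟩ :=
    ENNReal.exists_pos_sum_of_countable' (ENNReal.coe_pos.2 hε).ne' ι
  have hI : ∀ n, ∃ I, IsCenteredCover (A n) δ I ∧ ∑' p : I, g p < preH g δ (A n) + ε' n := by
    intro n
    have := ENNReal.lt_add_right (ENNReal.ne_top_of_tsum_ne_top hfin.ne n) (hε' n).ne'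
    simpa only [preH, iInf_lt_iff, exists_prop] using this
  choose I hI hlt using hI
  have hcov : IsCenteredCover (⋃ n, A n) δ (⋃ n, I n) := by
    refine ⟨countable_iUnion fun n => (hI n).1, fun p hp => ?_, iUnion_subset fun n => ?_⟩
    · obtain ⟨n, hn⟩ := mem_iUnion.1 hp
      exact ⟨mem_iUnion.2 ⟨n, ((hI n).2.1 p hn).1⟩, ((hI n).2.1 p hn).2⟩
    · exact (hI n).2.2.trans (biUnion_subset_biUnion_left (subset_iUnion I n))
  calc preH g δ (⋃ n, A n) ≤ ∑' p : ⋃ n, I n, g p := iInf₂_le _ hcov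
    _ ≤ ∑' n, ∑' p : I n, g p := ENNReal.tsum_iUnion_le_tsum g I
    _ ≤ ∑' n, (preH g δ (A n) + ε' n) := ENNReal.tsum_le_tsum fun n => (hlt n).le
    _ ≤ ∑' n, preH g δ (A n) + ε := by
        rw [ENNReal.tsum_add]
        gcongr

lemma preH_union_le {δ : ℝ} (A A' : Set Y) :
    preH g δ (A ∪ A') ≤ preH g δ A + preH g δ A' := by
  rw [union_eq_iUnion]
  exact (preH_iUnion_le _).trans_eq (by rw [tsum_bool]; exact add_comm _ _)

lemma barH_iUnion_le (A : ℕ → Set Y) : barH g (⋃ n, A n) ≤ ∑' n, barH g (A n) :=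
  iSup₂_le fun _ hδ => (preH_iUnion_le A).trans (ENNReal.tsum_le_tsum fun _ => preH_le_barH hδ _)

/-- The set function `mixedH g` as an outer measure. -/
def mixedHOuter (g : Y × ℝ → ℝ≥0∞) : OuterMeasure Y where
  measureOf := mixedH g
  empty := le_antisymm
    (iSup₂_le fun F hF => by rw [subset_empty_iff.1 hF, barH_empty]) zero_le
  mono h := mixedH_mono h
  iUnion_nat A _ := by
    refine iSup₂_le fun F hF => ?_
    rw [← inter_eq_left.2 hF, inter_iUnion]
    refine (barH_iUnion_le _).trans (ENNReal.tsum_le_tsum fun n => ?_)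
    exact (barH_le_mixedH _).trans (mixedH_mono inter_subset_right)

/-- The set function `mixedP g` as an outer measure. -/
def mixedPOuter (g : Y × ℝ → ℝ≥0∞) : OuterMeasure Y := OuterMeasure.ofFunction (barP g) barP_empty

lemma mixedHOuter_apply (A : Set Y) : mixedHOuter g A = mixedH g A := rfl

lemma mixedPOuter_apply (A : Set Y) : mixedPOuter g A = mixedP g A :=
  OuterMeasure.ofFunction_apply _ _ _

lemma mixedP_mono {A A' : Set Y} (hA : A ⊆ A') : mixedP g A ≤ mixedP g A' := by
  simpa only [mixedPOuter_apply] using measure_mono (μ := mixedPOuter g) hA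

lemma mixedP_le_barP (A : Set Y) : mixedP g A ≤ barP g A := by
  rw [← mixedPOuter_apply]
  exact OuterMeasure.ofFunction_le A

lemma mixedP_union_le (A A' : Set Y) : mixedP g (A ∪ A') ≤ mixedP g A + mixedP g A' := by
  simpa only [mixedPOuter_apply] using measure_union_le (μ := mixedPOuter g) A A'

lemma mixedP_iUnion_null {ι : Type*} [Countable ι] {A : ι → Set Y}
    (h : ∀ i, mixedP g (A i) = 0) : mixedP g (⋃ i, A i) = 0 := by
  simp only [← mixedPOuter_apply] at h ⊢
  exact measure_iUnion_null h

lemma exists_pos_le_dist {A A' : Set Y} (h : Metric.AreSeparated A A') :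
    ∃ r : ℝ, 0 < r ∧ ∀ x ∈ A, ∀ y ∈ A', r ≤ dist x y := by
  obtain ⟨r, hr0, hr⟩ := h
  rcases eq_or_ne r ⊤ with rfl | hr'
  · exact ⟨1, one_pos, fun x hx y hy => absurd (hr x hx y hy) (by simp [edist_ne_top])⟩
  · refine ⟨r.toReal, ENNReal.toReal_pos hr0 hr', fun x hx y hy => ?_⟩
    rw [dist_edist]
    exact ENNReal.toReal_mono (edist_ne_top _ _) (hr x hx y hy)

lemma tsum_add_tsum_le_of_disjoint {α : Type*} (f : α → ℝ≥0∞) {s s' u : Set α}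
    (h : Disjoint s s') (hs : s ⊆ u) (hs' : s' ⊆ u) :
    ∑' x : s, f x + ∑' x : s', f x ≤ ∑' x : u, f x := by
  rw [← Summable.tsum_union_disjoint h ENNReal.summable ENNReal.summable]
  exact ENNReal.tsum_mono_subtype f (union_subset hs hs')

lemma preH_add_le {A A' : Set Y} {r δ : ℝ} (hr : ∀ x ∈ A, ∀ y ∈ A', r ≤ dist x y) (h0 : 0 < r)
    (hδ : δ ≤ r) : preH g δ A + preH g δ A' ≤ preH g δ (A ∪ A') := by
  have key : ∀ {B B' : Set Y} {I : Set (Y × ℝ)}, (∀ x ∈ B, ∀ y ∈ B', r ≤ dist x y) →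
      IsCenteredCover (B ∪ B') δ I → IsCenteredCover B δ {p ∈ I | p.1 ∈ B} := by
    intro B B' I hBB hI
    refine ⟨hI.1.mono (sep_subset _ _), fun p hp => ⟨hp.2, (hI.2.1 p hp.1).2⟩, fun x hx => ?_⟩
    obtain ⟨p, hp, hxp⟩ := mem_iUnion₂.1 (hI.2.2 (Or.inl hx))
    refine mem_iUnion₂.2 ⟨p, ⟨hp, ?_⟩, hxp⟩
    refine (hI.2.1 p hp).1.resolve_right fun h => ?_
    have := hBB x hx _ h
    have := (hI.2.1 p hp).2.2
    rw [mem_closedBall] at hxp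
    linarith
  refine le_iInf₂ fun I hI => ?_
  refine (add_le_add (iInf₂_le _ (key hr hI)) (iInf₂_le _ (key (B := A') (B' := A)
    (fun x hx y hy => dist_comm y x ▸ hr y hy x hx) (union_comm A A' ▸ hI)))).trans ?_
  refine tsum_add_tsum_le_of_disjoint g ?_ (sep_subset _ _) (sep_subset _ _)
  refine Set.disjoint_left.2 fun p hp hp' => ?_
  have := hr _ hp.2 _ hp'.2
  rw [dist_self] at this
  linarith

lemma barH_add_le {A A' : Set Y} {r : ℝ} (hr : ∀ x ∈ A, ∀ y ∈ A', r ≤ dist x y) (h0 : 0 < r) :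
    barH g A + barH g A' ≤ barH g (A ∪ A') := by
  refine ENNReal.biSup_add_biSup_le' ⟨1, one_pos⟩ ⟨1, one_pos⟩ fun δ hδ δ' hδ' => ?_
  have hη : 0 < min r (min δ δ') := lt_min h0 (lt_min hδ hδ')
  calc preH g δ A + preH g δ' A'
      ≤ preH g (min r (min δ δ')) A + preH g (min r (min δ δ')) A' :=
        add_le_add (preH_anti ((min_le_right _ _).trans (min_le_left _ _)) _)
          (preH_anti ((min_le_right _ _).trans (min_le_right _ _)) _)
    _ ≤ preH g (min r (min δ δ')) (A ∪ A') := preH_add_le hr h0 (min_le_left _ _)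
    _ ≤ barH g (A ∪ A') := preH_le_barH hη _

lemma mixedHOuter_isMetric : (mixedHOuter g).IsMetric := by
  intro A A' h
  refine le_antisymm (measure_union_le _ _) ?_
  obtain ⟨r, h0, hr⟩ := exists_pos_le_dist h
  refine ENNReal.biSup_add_biSup_le' (p := fun F => F ⊆ A) (q := fun F => F ⊆ A')
    ⟨∅, empty_subset _⟩ ⟨∅, empty_subset _⟩ fun F hF F' hF' => ?_
  exact (barH_add_le (fun x hx y hy => hr x (hF hx) y (hF' hy)) h0).trans
    (le_iSup₂ (f := fun F (_ : F ⊆ A ∪ A') => barH g F) _ (union_subset_union hF hF'))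

lemma preP_add_le {A A' : Set Y} {r δ : ℝ} (hr : ∀ x ∈ A, ∀ y ∈ A', r ≤ dist x y) (h0 : 0 < r)
    (hδ : 2 * δ ≤ r) : preP g δ A + preP g δ A' ≤ preP g δ (A ∪ A') := by
  have hempty : ∀ B : Set Y, IsCenteredPacking B δ ∅ := fun B =>
    ⟨countable_empty, by simp, pairwise_empty _⟩
  refine ENNReal.biSup_add_biSup_le' ⟨∅, hempty A⟩ ⟨∅, hempty A'⟩ fun I hI I' hI' => ?_
  have hdisj : ∀ p ∈ I, ∀ p' ∈ I', Disjoint (closedBall p.1 p.2) (closedBall p'.1 p'.2) := by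
    intro p hp p' hp'
    refine closedBall_disjoint_closedBall ?_
    have := hr _ (hI.2.1 p hp).1 _ (hI'.2.1 p' hp').1
    have := (hI.2.1 p hp).2.2
    have := (hI'.2.1 p' hp').2.2
    linarith
  have hpack : IsCenteredPacking (A ∪ A') δ (I ∪ I') := by
    refine ⟨hI.1.union hI'.1, ?_, ?_⟩
    · rintro p (hp | hp)
      · exact ⟨Or.inl (hI.2.1 p hp).1, (hI.2.1 p hp).2⟩
      · exact ⟨Or.inr (hI'.2.1 p hp).1, (hI'.2.1 p hp).2⟩
    · rintro p (hp | hp) p' (hp' | hp') hne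
      · exact hI.2.2 hp hp' hne
      · exact hdisj p hp p' hp'
      · exact (hdisj p' hp' p hp).symm
      · exact hI'.2.2 hp hp' hne
  refine (tsum_add_tsum_le_of_disjoint g ?_ subset_union_left subset_union_right).trans
    hpack.tsum_le_preP
  refine Set.disjoint_left.2 fun p hp hp' => ?_
  have := hr _ (hI.2.1 p hp).1 _ (hI'.2.1 p hp').1
  rw [dist_self] at this
  linarith

lemma barP_add_le {A A' : Set Y} {r : ℝ} (hr : ∀ x ∈ A, ∀ y ∈ A', r ≤ dist x y) (h0 : 0 < r) :
    barP g A + barP g A' ≤ barP g (A ∪ A') := by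
  refine le_iInf₂ fun δ hδ => ?_
  have hη : 0 < min (r / 2) δ := lt_min (half_pos h0) hδ
  have h2 : 2 * min (r / 2) δ ≤ r := by
    have := min_le_left (r / 2) δ
    linarith
  calc barP g A + barP g A' ≤ preP g (min (r / 2) δ) A + preP g (min (r / 2) δ) A' :=
        add_le_add (iInf₂_le _ hη) (iInf₂_le _ hη)
    _ ≤ preP g (min (r / 2) δ) (A ∪ A') := preP_add_le hr h0 h2
    _ ≤ preP g δ (A ∪ A') := preP_mono (min_le_right _ _) Subset.rfl

lemma mixedPOuter_isMetric : (mixedPOuter g).IsMetric := by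
  intro A A' h
  refine le_antisymm (measure_union_le _ _) ?_
  obtain ⟨r, h0, hr⟩ := exists_pos_le_dist h
  simp only [mixedPOuter_apply]
  refine le_iInf₂ fun s hs => ?_
  have hsub : ∀ {B : Set Y}, B ⊆ A ∪ A' → B ⊆ ⋃ n, s n ∩ B := fun {B} hB => by
    rw [← iUnion_inter]
    exact subset_inter (hB.trans hs) Subset.rfl
  calc mixedP g A + mixedP g A'
      ≤ ∑' n, barP g (s n ∩ A) + ∑' n, barP g (s n ∩ A') :=
        add_le_add (iInf₂_le (fun n => s n ∩ A) (hsub subset_union_left))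
          (iInf₂_le (fun n => s n ∩ A') (hsub subset_union_right))
    _ = ∑' n, (barP g (s n ∩ A) + barP g (s n ∩ A')) := ENNReal.tsum_add.symm
    _ ≤ ∑' n, barP g (s n) := ENNReal.tsum_le_tsum fun n =>
        (barP_add_le (fun x hx y hy => hr x hx.2 y hy.2) h0).trans
          (barP_mono (union_subset inter_subset_left inter_subset_left))

variable [MeasurableSpace Y] [BorelSpace Y]

/-- The Borel measure induced by `mixedH g`. -/
def mixedHMeasure (g : Y × ℝ → ℝ≥0∞) : Measure Y :=
  (mixedHOuter g).toMeasure mixedHOuter_isMetric.le_caratheodory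

/-- The Borel measure induced by `mixedP g`. -/
def mixedPMeasure (g : Y × ℝ → ℝ≥0∞) : Measure Y :=
  (mixedPOuter g).toMeasure mixedPOuter_isMetric.le_caratheodory

lemma mixedHMeasure_apply {A : Set Y} (hA : MeasurableSet A) : mixedHMeasure g A = mixedH g A :=
  toMeasure_apply _ _ hA

lemma mixedPMeasure_apply {A : Set Y} (hA : MeasurableSet A) : mixedPMeasure g A = mixedP g A :=
  (toMeasure_apply _ _ hA).trans (mixedPOuter_apply A)

lemma mixedH_le_mixedHMeasure (A : Set Y) : mixedH g A ≤ mixedHMeasure g A :=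
  le_toMeasure_apply _ _ A

lemma mixedP_le_mixedPMeasure (A : Set Y) : mixedP g A ≤ mixedPMeasure g A :=
  (mixedPOuter_apply A).symm.trans_le (le_toMeasure_apply _ _ A)

variable {E : Set Y}

lemma isFiniteMeasure_mixedPMeasure_restrict (hE : MeasurableSet E) (hfin : mixedP g E < ⊤) :
    IsFiniteMeasure ((mixedPMeasure g).restrict E) :=
  ⟨by rwa [Measure.restrict_apply_univ, mixedPMeasure_apply hE]⟩

lemma isFiniteMeasure_mixedHMeasure_restrict (hE : MeasurableSet E) (hfin : mixedH g E < ⊤) :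
    IsFiniteMeasure ((mixedHMeasure g).restrict E) :=
  ⟨by rwa [Measure.restrict_apply_univ, mixedHMeasure_apply hE]⟩

lemma mixedHMeasure_restrict_closedBall (hE : MeasurableSet E) (x : Y) (r : ℝ) :
    (mixedHMeasure g).restrict E (closedBall x r) = mixedH g (E ∩ closedBall x r) := by
  rw [Measure.restrict_apply measurableSet_closedBall, inter_comm,
    mixedHMeasure_apply (hE.inter measurableSet_closedBall)]

lemma mixedPMeasure_restrict_closedBall (hE : MeasurableSet E) (x : Y) (r : ℝ) :
    (mixedPMeasure g).restrict E (closedBall x r) = mixedP g (E ∩ closedBall x r) := by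
  rw [Measure.restrict_apply measurableSet_closedBall, inter_comm,
    mixedPMeasure_apply (hE.inter measurableSet_closedBall)]

end OuterMeasures

section Comparison

variable {Y : Type*} [MetricSpace Y] {g : Y × ℝ → ℝ≥0∞}

lemma mixedH_le_mul_mixedP {E : Set Y} {C : ℝ≥0∞} (hC0 : C ≠ 0) (hC : C ≠ ⊤)
    (h : ∀ A ⊆ E, ∀ δ : ℝ, 0 < δ → preH g δ A ≤ C * preP g δ A) :
    mixedH g E ≤ C * mixedP g E := by
  have hbar : ∀ A ⊆ E, barH g A ≤ C * barP g A := by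
    intro A hA
    refine iSup₂_le fun δ hδ => ?_
    simp only [barP, ENNReal.mul_iInf_of_ne hC0 hC]
    refine le_iInf₂ fun δ' hδ' => ?_
    calc preH g δ A ≤ preH g (min δ δ') A := preH_anti (min_le_left _ _) A
      _ ≤ C * preP g (min δ δ') A := h A hA _ (lt_min hδ hδ')
      _ ≤ C * preP g δ' A := by
        gcongr
        exact preP_mono (min_le_right _ _) Subset.rfl
  simp only [mixedP, ENNReal.mul_iInf_of_ne hC0 hC]
  refine le_iInf₂ fun s hs => ?_
  have hsub : E ⊆ ⋃ n, s n ∩ E := by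
    rw [← iUnion_inter]
    exact subset_inter hs Subset.rfl
  calc mixedH g E ≤ ∑' n, mixedH g (s n ∩ E) := by
        simp only [← mixedHOuter_apply]
        exact (measure_mono hsub).trans (measure_iUnion_le _)
    _ ≤ ∑' n, C * barP g (s n) := ENNReal.tsum_le_tsum fun n => iSup₂_le fun F hF =>
        (hbar F (hF.trans inter_subset_right)).trans
          (mul_le_mul_right (barP_mono (hF.trans inter_subset_left)) C)
    _ = C * ∑' n, barP g (s n) := ENNReal.tsum_mul_left

lemma isCenteredPacking_image {A : Set Y} {δ : ℝ} {t : Set Y} {r : Y → ℝ} (htA : t ⊆ A)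
    (hr : ∀ x ∈ t, r x ∈ Ioo 0 δ) (hc : t.Countable)
    (hd : t.PairwiseDisjoint fun x => closedBall x (r x)) :
    IsCenteredPacking A δ ((fun x => (x, r x)) '' t) := by
  refine ⟨hc.image _, ?_, ?_⟩
  · rintro _ ⟨x, hx, rfl⟩
    exact ⟨htA hx, hr x hx⟩
  · rintro _ ⟨x, hx, rfl⟩ _ ⟨y, hy, rfl⟩ hne
    exact hd hx hy fun h => hne (by rw [h])

variable [SecondCountableTopology Y] [HasBesicovitchCovering Y]

variable (Y) in
lemma exists_preH_le_mul_preP :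
    ∃ N : ℕ, ∀ (g : Y × ℝ → ℝ≥0∞) (A : Set Y) (δ : ℝ), 0 < δ → preH g δ A ≤ N * preP g δ A := by
  obtain ⟨N, τ, hτ, hN⟩ := HasBesicovitchCovering.no_satelliteConfig (α := Y)
  refine ⟨N, fun g A δ hδ => ?_⟩
  obtain ⟨s, hs, hcov⟩ := Besicovitch.exist_disjoint_covering_families hτ hN
    (⟨Subtype.val, fun _ => δ / 2, fun _ => half_pos hδ, δ / 2, fun _ => le_rfl⟩ :
      Besicovitch.BallPackage A Y)
  have hpack : ∀ i, IsCenteredPacking A δ ((fun x => (x, δ / 2)) '' (Subtype.val '' s i)) := by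
    intro i
    have hd : (Subtype.val '' s i).PairwiseDisjoint fun x : Y => closedBall x (δ / 2) := by
      rintro _ ⟨x, hx, rfl⟩ _ ⟨y, hy, rfl⟩ hne
      exact hs i hx hy fun h => hne (by rw [h])
    refine isCenteredPacking_image (Subtype.coe_image_subset _ _)
      (fun _ _ => ⟨half_pos hδ, half_lt_self hδ⟩) ?_ hd
    refine hd.countable_of_nonempty_interior fun x _ => ⟨x, ?_⟩
    exact ball_subset_interior_closedBall (mem_ball_self (half_pos hδ))
  have hcover : IsCenteredCover A δ (⋃ i, (fun x => (x, δ / 2)) '' (Subtype.val '' s i)) := by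
    refine ⟨countable_iUnion fun i => (hpack i).1, fun p hp => ?_, fun x hx => ?_⟩
    · obtain ⟨i, hi⟩ := mem_iUnion.1 hp
      exact (hpack i).2.1 p hi
    · obtain ⟨i, hi⟩ := mem_iUnion.1 (hcov ⟨⟨x, hx⟩, rfl⟩)
      obtain ⟨y, hy, hxy⟩ := mem_iUnion₂.1 hi
      exact mem_iUnion₂.2 ⟨(y, δ / 2), mem_iUnion.2 ⟨i, y, ⟨y, hy, rfl⟩, rfl⟩,
        ball_subset_closedBall hxy⟩
  calc preH g δ A ≤ _ := iInf₂_le _ hcover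
    _ ≤ ∑ i : Fin N, ∑' p : (fun x => (x, δ / 2)) '' (Subtype.val '' s i), g p :=
        ENNReal.tsum_iUnion_le g _
    _ ≤ ∑ _i : Fin N, preP g δ A := Finset.sum_le_sum fun i _ => (hpack i).tsum_le_preP
    _ = N * preP g δ A := by simp

lemma mixedH_lt_top {E : Set Y} (hE : mixedP g E < ⊤) : mixedH g E < ⊤ := by
  obtain ⟨N, hN⟩ := exists_preH_le_mul_preP Y
  refine (mixedH_le_mul_mixedP (C := N + 1) (by simp) (by finiteness) fun A _ δ hδ =>
    (hN g A δ hδ).trans (mul_le_mul_left le_self_add _)).trans_lt ?_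
  exact ENNReal.mul_lt_top (by finiteness) hE

variable [MeasurableSpace Y] [BorelSpace Y]

/-- **Vitali covering theorem** for finite measures, in terms of centered packings. -/
lemma exists_packing_ae_cover (θ : Measure Y) [IsFiniteMeasure θ] {A : Set Y} {Q : Y → ℝ → Prop}
    (hQ : ∀ x ∈ A, ∃ᶠ r in 𝓝[>] (0 : ℝ), Q x r) {δ : ℝ} (hδ : 0 < δ) :
    ∃ I, IsCenteredPacking A δ I ∧ (∀ p ∈ I, Q p.1 p.2) ∧
      θ (A \ ⋃ p ∈ I, closedBall p.1 p.2) = 0 := by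
  obtain ⟨t, r, hc, htA, hr, hnull, hd⟩ := Besicovitch.exists_disjoint_closedBall_covering_ae θ
    (fun x => {r | Q x r}) A
    (fun x hx η hη => by
      obtain ⟨r, hr, hr'⟩ := ((hQ x hx).and_eventually (Ioo_mem_nhdsGT hη)).exists
      exact ⟨r, hr, hr'⟩)
    (fun _ => δ) (fun _ _ => hδ)
  refine ⟨_, isCenteredPacking_image htA (fun x hx => (hr x hx).2) hc hd, ?_, ?_⟩
  · rintro _ ⟨x, hx, rfl⟩
    exact (hr x hx).1
  · rwa [biUnion_image]

omit [SecondCountableTopology Y] [HasBesicovitchCovering Y] in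
lemma IsCenteredPacking.tsum_measure {δ : ℝ} {A : Set Y} {I : Set (Y × ℝ)}
    (hI : IsCenteredPacking A δ I) (θ : Measure Y) :
    ∑' p : I, θ (closedBall (p : Y × ℝ).1 (p : Y × ℝ).2) = θ (⋃ p ∈ I, closedBall p.1 p.2) :=
  (measure_biUnion hI.1 (fun _ hp _ hp' hne => hI.2.2 hp hp' hne)
    fun _ _ => measurableSet_closedBall).symm

lemma exists_packing_preH_le {E A : Set Y} (hE : MeasurableSet E) (hfin : mixedH g E < ⊤)
    (hA : A ⊆ E) {Q : Y → ℝ → Prop} (hQ : ∀ x ∈ A, ∃ᶠ r in 𝓝[>] (0 : ℝ), Q x r)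
    {δ : ℝ} (hδ : 0 < δ) :
    ∃ I, IsCenteredPacking A δ I ∧ (∀ p ∈ I, Q p.1 p.2) ∧ preH g δ A ≤ ∑' p : I, g p := by
  have := isFiniteMeasure_mixedHMeasure_restrict hE hfin
  obtain ⟨I, hI, hIQ, hnull⟩ := exists_packing_ae_cover ((mixedHMeasure g).restrict E) hQ hδ
  refine ⟨I, hI, hIQ, ?_⟩
  set L := A \ ⋃ p ∈ I, closedBall p.1 p.2 with hL
  have hL0 : preH g δ L = 0 := by
    rw [Measure.restrict_eq_self _ (sdiff_subset.trans hA)] at hnull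
    refine le_antisymm ?_ zero_le
    exact ((preH_le_barH hδ L).trans (barH_le_mixedH L)).trans
      ((mixedH_le_mixedHMeasure L).trans hnull.le)
  have hcov : IsCenteredCover (A ∩ ⋃ p ∈ I, closedBall p.1 p.2) δ I := by
    refine ⟨hI.1, fun p hp => ⟨⟨(hI.2.1 p hp).1, ?_⟩, (hI.2.1 p hp).2⟩, inter_subset_right⟩
    exact mem_iUnion₂.2 ⟨p, hp, mem_closedBall_self (hI.2.1 p hp).2.1.le⟩
  calc preH g δ A = preH g δ ((A ∩ ⋃ p ∈ I, closedBall p.1 p.2) ∪ L) := by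
        rw [hL, inter_union_sdiff]
    _ ≤ preH g δ (A ∩ ⋃ p ∈ I, closedBall p.1 p.2) + preH g δ L := preH_union_le _ _
    _ ≤ ∑' p : I, g p := by
        rw [hL0, add_zero]
        exact iInf₂_le _ hcov

lemma mixedH_le_mixedP {E : Set Y} (hE : MeasurableSet E) (hfin : mixedP g E < ⊤) {A : Set Y}
    (hA : A ⊆ E) : mixedH g A ≤ mixedP g A := by
  refine (mixedH_le_mul_mixedP (C := 1) one_ne_zero one_ne_top fun F hF δ hδ => ?_).trans_eq
    (one_mul _)
  obtain ⟨I, hI, -, hle⟩ := exists_packing_preH_le (Q := fun _ _ => True) hE (mixedH_lt_top hfin)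
    (hF.trans hA) (fun x _ => Frequently.of_forall fun _ => trivial) hδ
  rw [one_mul]
  exact hle.trans hI.tsum_le_preP

variable {θ : Measure Y} [IsFiniteMeasure θ] {c : ℝ≥0∞}

lemma mul_mixedH_le_of_frequently {E A : Set Y} (hE : MeasurableSet E) (hfin : mixedH g E < ⊤)
    (hA : A ⊆ E)
    (h : ∀ x ∈ A, ∃ᶠ r in 𝓝[>] (0 : ℝ), c * g (x, r) ≤ θ (closedBall x r)) :
    c * mixedH g A ≤ θ A := by
  refine ENNReal.le_of_forall_pos_le_add fun ε hε _ => ?_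
  obtain ⟨U, hAU, hU, hUε⟩ :=
    A.exists_isOpen_lt_add (μ := θ) (measure_ne_top _ _) (ENNReal.coe_pos.2 hε).ne'
  refine le_trans ?_ hUε.le
  simp only [mixedH, barH, ENNReal.mul_iSup]
  refine iSup₂_le fun F hF => iSup₂_le fun δ hδ => ?_
  have hfine : ∀ x ∈ F, ∃ᶠ r in 𝓝[>] (0 : ℝ),
      c * g (x, r) ≤ θ (closedBall x r) ∧ closedBall x r ⊆ U := by
    intro x hx
    refine (h x (hF hx)).and_eventually (mem_nhdsWithin_of_mem_nhds ?_)
    obtain ⟨η, hη, hball⟩ := Metric.isOpen_iff.1 hU x (hAU (hF hx))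
    filter_upwards [Iio_mem_nhds hη] with r hr
    exact (closedBall_subset_ball hr).trans hball
  obtain ⟨I, hI, hIQ, hle⟩ := exists_packing_preH_le hE hfin (hF.trans hA) hfine hδ
  calc c * preH g δ F ≤ c * ∑' p : I, g p := by gcongr
    _ = ∑' p : I, c * g p := ENNReal.tsum_mul_left.symm
    _ ≤ ∑' p : I, θ (closedBall (p : Y × ℝ).1 (p : Y × ℝ).2) :=
        ENNReal.tsum_le_tsum fun p => (hIQ p p.2).1
    _ = θ (⋃ p ∈ I, closedBall p.1 p.2) := hI.tsum_measure θ
    _ ≤ θ U := measure_mono (iUnion₂_subset fun p hp => (hIQ p hp).2)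

lemma measure_le_mul_mixedP_of_frequently {A : Set Y} (hc0 : c ≠ 0) (hc : c ≠ ⊤)
    (h : ∀ x ∈ A, ∃ᶠ r in 𝓝[>] (0 : ℝ), θ (closedBall x r) ≤ c * g (x, r)) :
    θ A ≤ c * mixedP g A := by
  have hbar : ∀ F ⊆ A, θ F ≤ c * barP g F := by
    intro F hF
    simp only [barP, ENNReal.mul_iInf_of_ne hc0 hc]
    refine le_iInf₂ fun δ hδ => ?_
    obtain ⟨I, hI, hIQ, hnull⟩ := exists_packing_ae_cover θ (fun x hx => h x (hF hx)) hδ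
    calc θ F ≤ θ (⋃ p ∈ I, closedBall p.1 p.2) := measure_mono_ae (ae_le_set.2 hnull)
      _ = ∑' p : I, θ (closedBall (p : Y × ℝ).1 (p : Y × ℝ).2) := (hI.tsum_measure θ).symm
      _ ≤ ∑' p : I, c * g p := ENNReal.tsum_le_tsum fun p => hIQ p p.2
      _ = c * ∑' p : I, g p := ENNReal.tsum_mul_left
      _ ≤ c * preP g δ F := by
        gcongr
        exact hI.tsum_le_preP
  simp only [mixedP, ENNReal.mul_iInf_of_ne hc0 hc]
  refine le_iInf₂ fun s hs => ?_
  have hsub : A ⊆ ⋃ n, s n ∩ A := by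
    rw [← iUnion_inter]
    exact subset_inter hs Subset.rfl
  calc θ A ≤ ∑' n, θ (s n ∩ A) := (measure_mono hsub).trans (measure_iUnion_le _)
    _ ≤ ∑' n, c * barP g (s n) := ENNReal.tsum_le_tsum fun n =>
        (hbar _ inter_subset_right).trans (mul_le_mul_right (barP_mono inter_subset_left) c)
    _ = c * ∑' n, barP g (s n) := ENNReal.tsum_mul_left

end Comparison

section RegularGauge

lemma exists_nat_forall_of_eventually {Q : ℝ → Prop} (h : ∀ᶠ r in 𝓝[>] (0 : ℝ), Q r) :
    ∃ n : ℕ, ∀ r ∈ Ioo (0 : ℝ) (1 / (n + 1)), Q r := by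
  obtain ⟨η, hη, hQ⟩ := (mem_nhdsGT_iff_exists_Ioo_subset' (zero_lt_one' ℝ)).1 h
  obtain ⟨n, hn⟩ := exists_nat_one_div_lt (mem_Ioi.1 hη)
  exact ⟨n, fun r hr => hQ ⟨hr.1, hr.2.trans hn⟩⟩

lemma monotone_setOf_forall_Ioo {α : Type*} (A : Set α) (Q : α → ℝ → Prop) :
    Monotone fun n : ℕ => {x ∈ A | ∀ r ∈ Ioo (0 : ℝ) (1 / (n + 1)), Q x r} :=
  fun _ _ hmn _ hx => ⟨hx.1, fun r hr =>
    hx.2 r ⟨hr.1, hr.2.trans_le (Nat.one_div_le_one_div hmn)⟩⟩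

variable {Y : Type*} [MeasurableSpace Y]

lemma measurableSet_exists_Ioo_lt {E : Set Y} (hE : MeasurableSet E) {a b : Y → ℝ → ℝ≥0∞}
    (ha : ∀ r, Measurable fun x => a x r) (hb : ∀ r, Measurable fun x => b x r)
    (ha' : ∀ x ∈ E, ∀ r, 0 < r → Tendsto (a x) (𝓝[>] r) (𝓝 (a x r)))
    (hb' : ∀ x ∈ E, ∀ r, 0 < r → Tendsto (b x) (𝓝[>] r) (𝓝 (b x r))) (δ : ℝ) :
    MeasurableSet {x ∈ E | ∃ r ∈ Ioo (0 : ℝ) δ, a x r < b x r} := by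
  have heq : {x ∈ E | ∃ r ∈ Ioo (0 : ℝ) δ, a x r < b x r} =
      ⋃ s : ℚ, {x ∈ E | (s : ℝ) ∈ Ioo (0 : ℝ) δ ∧ a x s < b x s} := by
    ext x
    simp only [mem_ofPred_eq, mem_iUnion]
    constructor
    · rintro ⟨hx, r, hr, hlt⟩
      have hev := ((ha' x hx r hr.1).eventually_lt (hb' x hx r hr.1) hlt).and
        (Ioo_mem_nhdsGT hr.2)
      obtain ⟨η, hη, hsub⟩ := (mem_nhdsGT_iff_exists_Ioo_subset' hr.2).1 hev
      obtain ⟨s, hs⟩ := exists_rat_btwn (mem_Ioi.1 hη)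
      have := hsub hs
      exact ⟨s, hx, ⟨hr.1.trans this.2.1, this.2.2⟩, this.1⟩
    · rintro ⟨s, hx, hs, hlt⟩
      exact ⟨hx, s, hs, hlt⟩
  rw [heq]
  exact MeasurableSet.iUnion fun s => hE.inter
    ((MeasurableSet.const _).inter (measurableSet_lt (ha s) (hb s)))

lemma measurableSet_frequently_lt {E : Set Y} (hE : MeasurableSet E) {a b : Y → ℝ → ℝ≥0∞}
    (ha : ∀ r, Measurable fun x => a x r) (hb : ∀ r, Measurable fun x => b x r)
    (ha' : ∀ x ∈ E, ∀ r, 0 < r → Tendsto (a x) (𝓝[>] r) (𝓝 (a x r)))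
    (hb' : ∀ x ∈ E, ∀ r, 0 < r → Tendsto (b x) (𝓝[>] r) (𝓝 (b x r))) :
    MeasurableSet {x ∈ E | ∃ᶠ r in 𝓝[>] (0 : ℝ), a x r < b x r} := by
  have heq : {x ∈ E | ∃ᶠ r in 𝓝[>] (0 : ℝ), a x r < b x r} =
      ⋂ n : ℕ, {x ∈ E | ∃ r ∈ Ioo (0 : ℝ) (1 / (n + 1)), a x r < b x r} := by
    ext x
    simp only [mem_ofPred_eq, mem_iInter]
    refine ⟨fun hx n => ⟨hx.1, ?_⟩, fun hx => ⟨(hx 0).1, fun hev => ?_⟩⟩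
    · obtain ⟨r, hr, hr'⟩ :=
        (hx.2.and_eventually (Ioo_mem_nhdsGT (Nat.one_div_pos_of_nat (n := n)))).exists
      exact ⟨r, hr', hr⟩
    · obtain ⟨n, hn⟩ := exists_nat_forall_of_eventually hev
      obtain ⟨r, hr, hlt⟩ := (hx n).2
      exact hn r hr hlt
  rw [heq]
  exact MeasurableSet.iInter fun n => measurableSet_exists_Ioo_lt hE ha hb ha' hb' _

/-- A gauge on balls that is Borel in the center and, for centers in `E`, nonzero, finite and
right-continuous in the radius. -/
structure IsRegularGauge (g : Y × ℝ → ℝ≥0∞) (E : Set Y) : Prop where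
  measurable : ∀ r, Measurable fun x => g (x, r)
  ne_zero : ∀ x ∈ E, ∀ r, 0 < r → g (x, r) ≠ 0
  ne_top : ∀ x ∈ E, ∀ r, 0 < r → g (x, r) ≠ ⊤
  tendsto : ∀ x ∈ E, ∀ r, 0 < r → Tendsto (fun s => g (x, s)) (𝓝[>] r) (𝓝 (g (x, r)))

lemma IsRegularGauge.tendsto_const_mul {g : Y × ℝ → ℝ≥0∞} {E : Set Y}
    (hg : IsRegularGauge g E) {c : ℝ≥0∞} (hc : c ≠ ⊤) :
    ∀ x ∈ E, ∀ r, 0 < r → Tendsto (fun s => c * g (x, s)) (𝓝[>] r) (𝓝 (c * g (x, r))) :=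
  fun x hx r hr => ENNReal.Tendsto.const_mul (hg.tendsto x hx r hr) (Or.inr hc)

end RegularGauge

section DensityBounds

variable {Y : Type*} [MetricSpace Y] [MeasurableSpace Y] [BorelSpace Y] {g : Y × ℝ → ℝ≥0∞}
  {θ : Measure Y} [IsFiniteMeasure θ] {c : ℝ≥0∞}

omit [BorelSpace Y] [IsFiniteMeasure θ] in
lemma measure_le_mul_mixedH_of_eventually {A : Set Y} (hc0 : c ≠ 0) (hc : c ≠ ⊤)
    (h : ∀ x ∈ A, ∀ᶠ r in 𝓝[>] (0 : ℝ), θ (closedBall x r) ≤ c * g (x, r)) :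
    θ A ≤ c * mixedH g A := by
  set V : ℕ → Set Y := fun n =>
    {x ∈ A | ∀ r ∈ Ioo (0 : ℝ) (1 / (n + 1)), θ (closedBall x r) ≤ c * g (x, r)}
  have hAV : A ⊆ ⋃ n, V n := fun x hx =>
    let ⟨n, hn⟩ := exists_nat_forall_of_eventually (h x hx)
    mem_iUnion.2 ⟨n, hx, hn⟩
  refine (measure_mono hAV).trans ?_
  rw [(monotone_setOf_forall_Ioo A _).measure_iUnion]
  refine iSup_le fun n => ?_
  have hδ : (0 : ℝ) < 1 / (n + 1) := Nat.one_div_pos_of_nat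
  refine le_trans ?_ (mul_le_mul_right ((preH_le_barH hδ (V n)).trans
    ((barH_le_mixedH _).trans (mixedH_mono (sep_subset _ _)))) c)
  simp only [preH, ENNReal.mul_iInf_of_ne hc0 hc]
  refine le_iInf₂ fun I hI => ?_
  calc θ (V n) ≤ θ (⋃ p ∈ I, closedBall p.1 p.2) := measure_mono hI.2.2
    _ ≤ ∑' p : I, θ (closedBall (p : Y × ℝ).1 (p : Y × ℝ).2) := measure_biUnion_le θ hI.1 _
    _ ≤ ∑' p : I, c * g p := ENNReal.tsum_le_tsum fun p =>
        (hI.2.1 p p.2).1.2 _ (hI.2.1 p p.2).2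
    _ = c * ∑' p : I, g p := ENNReal.tsum_mul_left

lemma measurable_measure_closedBall [SecondCountableTopology Y] (r : ℝ) :
    Measurable fun x => θ (closedBall x r) := by
  have hS : MeasurableSet {p : Y × Y | dist p.2 p.1 ≤ r} :=
    (isClosed_le (continuous_snd.dist continuous_fst) continuous_const).measurableSet
  exact measurable_measure_prodMk_left hS

variable (θ) in
lemma tendsto_measure_closedBall_nhdsGT (x : Y) (r : ℝ) :
    Tendsto (fun s => θ (closedBall x s)) (𝓝[>] r) (𝓝 (θ (closedBall x r))) := by
  have h := tendsto_measure_biInter_gt (μ := θ) (s := fun s => closedBall x s) (a := r)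
    (fun _ _ => measurableSet_closedBall.nullMeasurableSet)
    (fun _ _ _ hij => closedBall_subset_closedBall hij) ⟨r + 1, by simp, measure_ne_top _ _⟩
  have heq : ⋂ s, ⋂ (_ : s > r), closedBall x s = closedBall x r := by
    ext y
    simp only [mem_iInter, mem_closedBall]
    exact ⟨le_of_forall_gt_imp_ge_of_dense, fun h s hs => h.trans hs.le⟩
  rwa [heq] at h

variable {E : Set Y}

lemma mul_mixedP_le_of_isClosed {K : Set Y} (hK : IsClosed K) {δ : ℝ} (hδ : 0 < δ)
    (h : ∀ x ∈ K, ∀ r ∈ Ioo 0 δ, c * g (x, r) ≤ θ (closedBall x r)) :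
    c * mixedP g K ≤ θ K := by
  have hlim : Tendsto (fun r => θ (cthickening r K)) (𝓝[>] (0 : ℝ)) (𝓝 (θ K)) :=
    (tendsto_measure_cthickening_of_isClosed ⟨1, one_pos, measure_ne_top _ _⟩ hK).mono_left
      nhdsWithin_le_nhds
  refine ge_of_tendsto hlim ?_
  filter_upwards [Ioo_mem_nhdsGT hδ] with η hη
  calc c * mixedP g K ≤ c * preP g η K := by
        gcongr
        exact (mixedP_le_barP K).trans (iInf₂_le η hη.1)
    _ ≤ θ (cthickening η K) := by
        simp only [preP, ENNReal.mul_iSup]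
        refine iSup₂_le fun I hI => ?_
        calc c * ∑' p : I, g p = ∑' p : I, c * g p := ENNReal.tsum_mul_left.symm
          _ ≤ ∑' p : I, θ (closedBall (p : Y × ℝ).1 (p : Y × ℝ).2) :=
              ENNReal.tsum_le_tsum fun p => h _ (hI.2.1 p p.2).1 _
                ⟨(hI.2.1 p p.2).2.1, (hI.2.1 p p.2).2.2.trans hη.2⟩
          _ = θ (⋃ p ∈ I, closedBall p.1 p.2) := hI.tsum_measure θ
          _ ≤ θ (cthickening η K) := measure_mono <| iUnion₂_subset fun p hp =>
              (closedBall_subset_cthickening (hI.2.1 p hp).1 _).trans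
                (cthickening_mono (hI.2.1 p hp).2.2.le K)

lemma mul_mixedP_le_of_eventually [SecondCountableTopology Y] (hg : IsRegularGauge g E)
    (hE : MeasurableSet E) (hfin : mixedP g E < ⊤) {A : Set Y} (hA : MeasurableSet A)
    (hAE : A ⊆ E) (hc : c ≠ ⊤)
    (h : ∀ x ∈ A, ∀ᶠ r in 𝓝[>] (0 : ℝ), c * g (x, r) ≤ θ (closedBall x r)) :
    c * mixedP g A ≤ θ A := by
  have := isFiniteMeasure_mixedPMeasure_restrict hE hfin
  set ρ := (mixedPMeasure g).restrict E with hρ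
  have hρ_apply : ∀ {B : Set Y}, MeasurableSet B → B ⊆ E → ρ B = mixedP g B := fun hB hBE => by
    rw [hρ, Measure.restrict_eq_self _ hBE, mixedPMeasure_apply hB]
  set W : ℕ → Set Y := fun n =>
    {x ∈ A | ∀ r ∈ Ioo (0 : ℝ) (1 / (n + 1)), c * g (x, r) ≤ θ (closedBall x r)} with hW
  have hWm : ∀ n, MeasurableSet (W n) := fun n => by
    have := hA.diff (measurableSet_exists_Ioo_lt hE (fun r => measurable_measure_closedBall r)
      (fun r => (hg.measurable r).const_mul c)
      (fun x _ r _ => tendsto_measure_closedBall_nhdsGT θ x r)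
      (hg.tendsto_const_mul hc) (1 / (n + 1)))
    convert this using 1
    ext x
    simp only [hW, mem_ofPred_eq, Set.mem_sdiff, not_and, not_exists, not_lt]
    exact ⟨fun hx => ⟨hx.1, fun _ => hx.2⟩, fun hx => ⟨hx.1, hx.2 (hAE hx.1)⟩⟩
  have hAW : A ⊆ ⋃ n, W n := fun x hx =>
    let ⟨n, hn⟩ := exists_nat_forall_of_eventually (h x hx)
    mem_iUnion.2 ⟨n, hx, hn⟩
  rw [← hρ_apply hA hAE]
  refine (mul_le_mul_right (measure_mono hAW) c).trans ?_
  rw [(monotone_setOf_forall_Ioo A _).measure_iUnion, ENNReal.mul_iSup]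
  refine iSup_le fun n => ?_
  rw [(hWm n).measure_eq_iSup_isClosed_of_ne_top (measure_ne_top _ _)]
  simp only [ENNReal.mul_iSup]
  refine iSup₂_le fun K hKW => iSup_le fun hK => ?_
  rw [hρ_apply hK.measurableSet (hKW.trans ((sep_subset _ _).trans hAE))]
  exact (mul_mixedP_le_of_isClosed hK Nat.one_div_pos_of_nat fun x hx => (hKW hx).2).trans
    (measure_mono (hKW.trans (sep_subset _ _)))

end DensityBounds

section DensityOne

variable {Y : Type*} [MetricSpace Y] [SecondCountableTopology Y] [HasBesicovitchCovering Y]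
  [MeasurableSpace Y] [BorelSpace Y] {g : Y × ℝ → ℝ≥0∞} {E : Set Y}

lemma mixedH_eq_mixedP_of_one_le_liminf (hg : IsRegularGauge g E) (hE : MeasurableSet E)
    (hfin : mixedP g E < ⊤)
    (hnull : mixedP g {x ∈ E | ¬ 1 ≤ liminf
      (fun r => mixedH g (E ∩ closedBall x r) / g (x, r)) (𝓝[>] (0 : ℝ))} = 0)
    {F : Set Y} (hFE : F ⊆ E) (hF : MeasurableSet F) : mixedH g F = mixedP g F := by
  refine le_antisymm (mixedH_le_mixedP hE hfin hFE) ?_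
  refine ENNReal.le_of_forall_lt_one_mul_le fun c hc => ?_
  have := isFiniteMeasure_mixedHMeasure_restrict hE (mixedH_lt_top hfin)
  set θ := (mixedHMeasure g).restrict E with hθ
  set N := {x ∈ E | ¬ 1 ≤ liminf
    (fun r => mixedH g (E ∩ closedBall x r) / g (x, r)) (𝓝[>] (0 : ℝ))} with hN
  set B := {x ∈ E | ∃ᶠ r in 𝓝[>] (0 : ℝ), θ (closedBall x r) < c * g (x, r)} with hB
  have hBm : MeasurableSet B := measurableSet_frequently_lt hE
    (fun r => measurable_measure_closedBall r) (fun r => (hg.measurable r).const_mul c)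
    (fun x _ r _ => tendsto_measure_closedBall_nhdsGT θ x r) (hg.tendsto_const_mul hc.ne_top)
  have hsub : F ⊆ N ∪ F \ B := by
    intro x hx
    by_contra hcon
    simp only [mem_union, Set.mem_sdiff, hx, true_and, not_or, not_not] at hcon
    obtain ⟨hxN, -, hxB⟩ := hcon
    have h1 : 1 ≤ liminf
        (fun r => mixedH g (E ∩ closedBall x r) / g (x, r)) (𝓝[>] (0 : ℝ)) :=
      not_not.1 fun h => hxN ⟨hFE hx, h⟩
    obtain ⟨r, hlt, hlt', hr⟩ := (hxB.and_eventually
      ((eventually_lt_of_lt_liminf (hc.trans_le h1)).and self_mem_nhdsWithin)).exists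
    rw [ENNReal.lt_div_iff_mul_lt (Or.inl (hg.ne_zero x (hFE hx) r hr))
      (Or.inl (hg.ne_top x (hFE hx) r hr)), ← mixedHMeasure_restrict_closedBall hE] at hlt'
    exact hlt.not_gt hlt'
  calc c * mixedP g F ≤ c * mixedP g (F \ B) := by
        gcongr
        refine (mixedP_mono hsub).trans ((mixedP_union_le _ _).trans ?_)
        rw [hnull, zero_add]
    _ ≤ θ (F \ B) := mul_mixedP_le_of_eventually hg hE hfin (hF.diff hBm)
        (sdiff_subset.trans hFE) hc.ne_top fun x hx => by
          have : ¬ ∃ᶠ r in 𝓝[>] (0 : ℝ), θ (closedBall x r) < c * g (x, r) :=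
            fun h => hx.2 ⟨hFE hx.1, h⟩
          simpa only [not_frequently, not_lt] using this
    _ ≤ θ F := measure_mono sdiff_subset
    _ = mixedH g F := by rw [hθ, Measure.restrict_eq_self _ hFE, mixedHMeasure_apply hF]

lemma mixedH_eq_mixedP_of_limsup_le_one (hg : IsRegularGauge g E) (hE : MeasurableSet E)
    (hfin : mixedP g E < ⊤)
    (hnull : mixedP g {x ∈ E | ¬ limsup
      (fun r => mixedP g (E ∩ closedBall x r) / g (x, r)) (𝓝[>] (0 : ℝ)) ≤ 1} = 0)
    {F : Set Y} (hFE : F ⊆ E) : mixedH g F = mixedP g F := by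
  refine le_antisymm (mixedH_le_mixedP hE hfin hFE) ?_
  have := isFiniteMeasure_mixedPMeasure_restrict hE hfin
  set θ := (mixedPMeasure g).restrict E with hθ
  set N := {x ∈ E | ¬ limsup
    (fun r => mixedP g (E ∩ closedBall x r) / g (x, r)) (𝓝[>] (0 : ℝ)) ≤ 1} with hN
  have hP : mixedP g F ≤ mixedP g (F \ N) := by
    refine (mixedP_mono (A' := N ∪ F \ N) (by simp)).trans ((mixedP_union_le _ _).trans ?_)
    rw [hnull, zero_add]
  have hmul : ∀ c : ℝ≥0∞, 1 < c → c ≠ ⊤ → mixedP g F ≤ c * mixedH g F := by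
    intro c hc hc'
    calc mixedP g F ≤ mixedPMeasure g (F \ N) := hP.trans (mixedP_le_mixedPMeasure _)
      _ = θ (F \ N) := by rw [hθ, Measure.restrict_eq_self _ (sdiff_subset.trans hFE)]
      _ ≤ c * mixedH g (F \ N) := by
          refine measure_le_mul_mixedH_of_eventually (one_pos.trans hc).ne' hc' fun x hx => ?_
          have h1 : limsup (fun r => mixedP g (E ∩ closedBall x r) / g (x, r))
              (𝓝[>] (0 : ℝ)) ≤ 1 := not_not.1 fun h => hx.2 ⟨hFE hx.1, h⟩
          filter_upwards [eventually_lt_of_limsup_lt (h1.trans_lt hc), self_mem_nhdsWithin]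
            with r hr hr0
          rw [hθ, mixedPMeasure_restrict_closedBall hE,
            ← ENNReal.div_le_iff (hg.ne_zero x (hFE hx.1) r hr0) (hg.ne_top x (hFE hx.1) r hr0)]
          exact hr.le
      _ ≤ c * mixedH g F := by
          gcongr
          exact mixedH_mono sdiff_subset
  refine ENNReal.le_of_forall_lt_one_mul_le fun c hc => ?_
  rcases eq_or_ne c 0 with rfl | hc0
  · simp
  rw [ENNReal.mul_le_iff_le_inv hc0 hc.ne_top]
  exact hmul _ (ENNReal.one_lt_inv.2 hc) (ENNReal.inv_ne_top.2 hc0)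

lemma mixedP_lowerDensity_lt_one_eq_zero (hg : IsRegularGauge g E) (hE : MeasurableSet E)
    (hfin : mixedP g E < ⊤) :
    mixedP g {x ∈ E | liminf
      (fun r => mixedP g (E ∩ closedBall x r) / g (x, r)) (𝓝[>] (0 : ℝ)) < 1} = 0 := by
  have := isFiniteMeasure_mixedPMeasure_restrict hE hfin
  set θ := (mixedPMeasure g).restrict E with hθ
  set A : ℚ → Set Y := fun s => {x ∈ E | 0 < (s : ℝ).toNNReal ∧ (s : ℝ).toNNReal < 1 ∧
    ∃ᶠ r in 𝓝[>] (0 : ℝ), θ (closedBall x r) ≤ (s : ℝ).toNNReal * g (x, r)} with hA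
  have hA0 : ∀ s, mixedP g (A s) = 0 := by
    intro s
    rcases (A s).eq_empty_or_nonempty with h | ⟨y, hy⟩
    · exact le_antisymm ((mixedP_le_barP _).trans_eq (by rw [h, barP_empty])) zero_le
    by_contra hne
    have hlt : mixedP g (A s) < ⊤ := (mixedP_mono (sep_subset _ _)).trans_lt hfin
    have hle : mixedP g (A s) ≤ (s : ℝ).toNNReal * mixedP g (A s) :=
      calc mixedP g (A s) ≤ mixedPMeasure g (A s) := mixedP_le_mixedPMeasure _
        _ = θ (A s) := by rw [hθ, Measure.restrict_eq_self _ (sep_subset _ _)]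
        _ ≤ _ := measure_le_mul_mixedP_of_frequently (ENNReal.coe_pos.2 hy.2.1).ne' coe_ne_top
          fun x hx => hx.2.2.2
    have := ENNReal.mul_lt_mul_left hne hlt.ne (ENNReal.coe_lt_one_iff.2 hy.2.2.1)
    rw [one_mul] at this
    exact hle.not_gt this
  refine le_antisymm ((mixedP_mono fun x hx => ?_).trans_eq (mixedP_iUnion_null hA0)) zero_le
  obtain ⟨s, -, hs, hs1⟩ := ENNReal.lt_iff_exists_rat_btwn.1 hx.2
  refine mem_iUnion.2 ⟨s, hx.1, ENNReal.coe_pos.1 (zero_le.trans_lt hs),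
    ENNReal.coe_lt_one_iff.1 hs1, ?_⟩
  refine ((frequently_lt_of_liminf_lt (by isBoundedDefault) hs).and_eventually
    self_mem_nhdsWithin).mono fun r hr => ?_
  rw [hθ, mixedPMeasure_restrict_closedBall hE,
    ← ENNReal.div_le_iff (hg.ne_zero x hx.1 r hr.2) (hg.ne_top x hx.1 r hr.2)]
  exact hr.1.le

lemma mixedP_one_lt_upperDensity_eq_zero (hg : IsRegularGauge g E) (hE : MeasurableSet E)
    (hfin : mixedP g E < ⊤) (heq : ∀ F ⊆ E, MeasurableSet F → mixedH g F = mixedP g F) :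
    mixedP g {x ∈ E | 1 < limsup
      (fun r => mixedP g (E ∩ closedBall x r) / g (x, r)) (𝓝[>] (0 : ℝ))} = 0 := by
  have := isFiniteMeasure_mixedPMeasure_restrict hE hfin
  set θ := (mixedPMeasure g).restrict E with hθ
  set A : ℚ → Set Y := fun s => {x ∈ E |
    ∃ᶠ r in 𝓝[>] (0 : ℝ), (s : ℝ).toNNReal * g (x, r) < θ (closedBall x r)} with hA
  have hA0 : ∀ s : {s : ℚ // 1 < (s : ℝ).toNNReal}, mixedP g (A s) = 0 := by
    rintro ⟨s, hs⟩
    have hAm : MeasurableSet (A s) := measurableSet_frequently_lt hE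
      (fun r => (hg.measurable r).const_mul _) (fun r => measurable_measure_closedBall r)
      (hg.tendsto_const_mul coe_ne_top) (fun x _ r _ => tendsto_measure_closedBall_nhdsGT θ x r)
    by_contra hne
    have hlt : mixedP g (A s) < ⊤ := (mixedP_mono (sep_subset _ _)).trans_lt hfin
    have hle : (s : ℝ).toNNReal * mixedP g (A s) ≤ mixedP g (A s) := by
      have h := mul_mixedH_le_of_frequently (θ := θ) hE (mixedH_lt_top hfin)
        (sep_subset _ _ : A s ⊆ E) fun x hx => hx.2.mono fun r hr => hr.le
      rwa [heq _ (sep_subset _ _) hAm, hθ, Measure.restrict_eq_self _ (sep_subset _ _),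
        mixedPMeasure_apply hAm] at h
    have := ENNReal.mul_lt_mul_left hne hlt.ne (ENNReal.one_lt_coe_iff.2 hs)
    rw [one_mul] at this
    exact hle.not_gt this
  refine le_antisymm ((mixedP_mono fun x hx => ?_).trans_eq (mixedP_iUnion_null hA0)) zero_le
  obtain ⟨s, -, hs1, hs⟩ := ENNReal.lt_iff_exists_rat_btwn.1 hx.2
  refine mem_iUnion.2 ⟨⟨s, ENNReal.one_lt_coe_iff.1 hs1⟩, hx.1, ?_⟩
  refine ((frequently_lt_of_lt_limsup (by isBoundedDefault) hs).and_eventually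
    self_mem_nhdsWithin).mono fun r hr => ?_
  rw [hθ, mixedPMeasure_restrict_closedBall hE, ← ENNReal.lt_div_iff_mul_lt
    (Or.inl (hg.ne_zero x hx.1 r hr.2)) (Or.inl (hg.ne_top x hx.1 r hr.2))]
  exact hr.1

lemma mixedP_density_ne_one_eq_zero (hg : IsRegularGauge g E) (hE : MeasurableSet E)
    (hfin : mixedP g E < ⊤) (heq : ∀ F ⊆ E, MeasurableSet F → mixedH g F = mixedP g F) :
    mixedP g {x ∈ E | ¬ (
      limsup (fun r => mixedP g (E ∩ closedBall x r) / g (x, r)) (𝓝[>] (0 : ℝ)) = 1 ∧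
      liminf (fun r => mixedP g (E ∩ closedBall x r) / g (x, r)) (𝓝[>] (0 : ℝ)) = 1)} = 0 := by
  have hunion := mixedP_union_le (g := g) _ _ |>.trans_eq <| congrArg₂ (· + ·)
    (mixedP_one_lt_upperDensity_eq_zero hg hE hfin heq)
    (mixedP_lowerDensity_lt_one_eq_zero hg hE hfin)
  rw [add_zero] at hunion
  refine le_antisymm ((mixedP_mono fun x hx => ?_).trans hunion) zero_le
  by_contra hcon
  simp only [mem_union, mem_ofPred_eq, hx.1, true_and, not_or, not_lt] at hcon
  have hle := liminf_le_limsup (f := 𝓝[>] (0 : ℝ))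
    (u := fun r => mixedP g (E ∩ closedBall x r) / g (x, r))
  exact hx.2 ⟨le_antisymm hcon.1 (hcon.2.trans hle), le_antisymm (hle.trans hcon.1) hcon.2⟩

end DensityOne

lemma isRegularGauge_mgauge [BorelSpace X] [SecondCountableTopology X] {k : ℕ}
    (μ : Fin k → Measure X) (ν : Measure X) [∀ j, IsFiniteMeasure (μ j)] [IsFiniteMeasure ν]
    (q : Fin k → ℝ) (t : ℝ) : IsRegularGauge (mgauge μ q ν t) (Smu μ ∩ msupport ν) := by
  have hpow : ∀ (σ : Measure X) [IsFiniteMeasure σ] (s : ℝ), ∀ x ∈ msupport σ, ∀ r, 0 < r →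
      σ (closedBall x r) ^ s ≠ 0 ∧ σ (closedBall x r) ^ s ≠ ⊤ := fun σ _ s x hx r hr =>
    ⟨(ENNReal.rpow_pos (hx r hr) (measure_ne_top _ _)).ne',
      ENNReal.rpow_ne_top_of_ne_zero (hx r hr).ne' (measure_ne_top _ _)⟩
  have hμ : ∀ x ∈ Smu μ, ∀ j, x ∈ msupport (μ j) := fun x hx => mem_iInter.1 hx
  refine ⟨fun r => ?_, fun x hx r hr => ?_, fun x hx r hr => ?_, fun x hx r hr => ?_⟩
  · exact (Finset.measurable_fun_prod _ fun j _ =>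
      (measurable_measure_closedBall r).pow_const _).mul
        ((measurable_measure_closedBall r).pow_const _)
  · exact mul_ne_zero (Finset.prod_ne_zero_iff.2 fun j _ => (hpow _ _ x (hμ x hx.1 j) r hr).1)
      (hpow _ _ x hx.2 r hr).1
  · exact ENNReal.mul_ne_top (ENNReal.prod_ne_top fun j _ => (hpow _ _ x (hμ x hx.1 j) r hr).2)
      (hpow _ _ x hx.2 r hr).2
  · have htend : ∀ (σ : Measure X) [IsFiniteMeasure σ] (s : ℝ),
        Tendsto (fun u => σ (closedBall x u) ^ s) (𝓝[>] r) (𝓝 (σ (closedBall x r) ^ s)) :=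
      fun σ _ s => (ENNReal.continuous_rpow_const.tendsto _).comp
        (tendsto_measure_closedBall_nhdsGT σ x r)
    refine ENNReal.Tendsto.mul
      (ENNReal.tendsto_finsetProd_of_ne_top _ (fun j _ => htend (μ j) (q j))
        fun j _ => (hpow _ _ x (hμ x hx.1 j) r hr).2)
      (Or.inr (hpow _ _ x hx.2 r hr).2) (htend ν t) (Or.inr ?_)
    exact ENNReal.prod_ne_top fun j _ => (hpow _ _ x (hμ x hx.1 j) r hr).2

lemma IsRegularGauge.mono {Y : Type*} [MeasurableSpace Y] {g : Y × ℝ → ℝ≥0∞} {E E' : Set Y}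
    (hg : IsRegularGauge g E') (h : E ⊆ E') : IsRegularGauge g E :=
  ⟨hg.measurable, fun x hx => hg.ne_zero x (h hx), fun x hx => hg.ne_top x (h hx),
    fun x hx => hg.tendsto x (h hx)⟩

/-- under doubling assumptions and `0 < P^{q,t}_{μ,ν}(E) < ∞`, the three
conditions (a) `H^{q,t} = P^{q,t}` on Borel subsets of `E`; (b) `D̄ = D̲ = 1`
`P^{q,t}`-a.e. on `E`; (c) `Δ̄ = Δ̲ = 1` `P^{q,t}`-a.e. on `E` are equivalent. -/
theorem mixedH_eq_mixedP_iff_density_one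
    (d k : ℕ) (hd : 1 ≤ d) (hk : 1 ≤ k)
    (μ : Fin k → Measure (Rd d)) (ν : Measure (Rd d))
    (hμ : ∀ j, IsProbabilityMeasure (μ j)) (hν : IsProbabilityMeasure ν)
    (hμD : ∀ j, IsDoubling (μ j)) (hνD : IsDoubling ν)
    (q : Fin k → ℝ) (t : ℝ)
    (E : Set (Rd d)) (hE : MeasurableSet E) (hES : E ⊆ Smu μ ∩ msupport ν)
    (h0 : 0 < mixedP (mgauge μ q ν t) E) (hfin : mixedP (mgauge μ q ν t) E < ⊤) :
    ((∀ F : Set (Rd d), F ⊆ E → MeasurableSet F →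
        mixedH (mgauge μ q ν t) F = mixedP (mgauge μ q ν t) F) ↔
      mixedP (mgauge μ q ν t)
        {x ∈ E | ¬ (DUpper μ q ν t E x = 1 ∧ DLower μ q ν t E x = 1)} = 0) ∧
    (mixedP (mgauge μ q ν t)
        {x ∈ E | ¬ (DUpper μ q ν t E x = 1 ∧ DLower μ q ν t E x = 1)} = 0 ↔
      mixedP (mgauge μ q ν t)
        {x ∈ E | ¬ (DeltaUpper μ q ν t E x = 1 ∧ DeltaLower μ q ν t E x = 1)} = 0) := by
  have hg : IsRegularGauge (mgauge μ q ν t) E := (isRegularGauge_mgauge μ ν q t).mono hES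
  have eq_of_D : mixedP (mgauge μ q ν t)
      {x ∈ E | ¬ (DUpper μ q ν t E x = 1 ∧ DLower μ q ν t E x = 1)} = 0 →
      ∀ F : Set (Rd d), F ⊆ E → MeasurableSet F →
        mixedH (mgauge μ q ν t) F = mixedP (mgauge μ q ν t) F := fun h F hFE hF =>
    mixedH_eq_mixedP_of_one_le_liminf hg hE hfin (le_antisymm ((mixedP_mono
      fun _ hx => And.intro hx.1 fun h' => hx.2 h'.2.ge).trans_eq h) zero_le) hFE hF
  have eq_of_Delta : mixedP (mgauge μ q ν t)
      {x ∈ E | ¬ (DeltaUpper μ q ν t E x = 1 ∧ DeltaLower μ q ν t E x = 1)} = 0 →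
      ∀ F : Set (Rd d), F ⊆ E → MeasurableSet F →
        mixedH (mgauge μ q ν t) F = mixedP (mgauge μ q ν t) F := fun h F hFE _ =>
    mixedH_eq_mixedP_of_limsup_le_one hg hE hfin (le_antisymm ((mixedP_mono
      fun _ hx => And.intro hx.1 fun h' => hx.2 h'.1.le).trans_eq h) zero_le) hFE
  have Delta_of_eq : (∀ F : Set (Rd d), F ⊆ E → MeasurableSet F →
        mixedH (mgauge μ q ν t) F = mixedP (mgauge μ q ν t) F) →
      mixedP (mgauge μ q ν t)
        {x ∈ E | ¬ (DeltaUpper μ q ν t E x = 1 ∧ DeltaLower μ q ν t E x = 1)} = 0 :=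
    mixedP_density_ne_one_eq_zero hg hE hfin
  have D_of_eq : (∀ F : Set (Rd d), F ⊆ E → MeasurableSet F →
        mixedH (mgauge μ q ν t) F = mixedP (mgauge μ q ν t) F) →
      mixedP (mgauge μ q ν t)
        {x ∈ E | ¬ (DUpper μ q ν t E x = 1 ∧ DLower μ q ν t E x = 1)} = 0 := by
    intro h
    have hball : ∀ x r, mixedH (mgauge μ q ν t) (E ∩ closedBall x r) =
        mixedP (mgauge μ q ν t) (E ∩ closedBall x r) := fun x r =>
      h _ inter_subset_left (hE.inter measurableSet_closedBall)
    simp only [DUpper, DLower, upperSetDensity, lowerSetDensity, hball]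
    exact Delta_of_eq h
  exact ⟨⟨D_of_eq, eq_of_D⟩, fun h => Delta_of_eq (eq_of_D h), fun h => D_of_eq (eq_of_Delta h)⟩

end MixedMultifractal
end
end

section
/- Suppose each μⱼ and ν are doubling, let E ⊆ S_μ ∩ S_ν be a Borel set with H^{q,t}_{μ,ν}(E) < ∞, let θ be a Borel probability measure on ℝ^d and define λ_E(A) = θ(A ∖ E) for Borel sets A. Then d̄^{q,t}_{μ,ν}(x, λ_E) = 0 for H^{q,t}_{μ,ν}-almost every x ∈ E. -/
open MeasureTheory Metric Set Filter ENNReal Topology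

noncomputable section

namespace MixedMultifractal

variable {X : Type*} [MetricSpace X] [MeasurableSpace X]

theorem IsCenteredCover.iUnion {Y : Type*} [MetricSpace Y] {δ : ℝ} {F : ℕ → Set Y}
    {I : ℕ → Set (Y × ℝ)} (hI : ∀ n, IsCenteredCover (F n) δ (I n)) :
    IsCenteredCover (⋃ n, F n) δ (⋃ n, I n) := by
  refine ⟨countable_iUnion fun n => (hI n).1, ?_, ?_⟩
  · intro p hp
    obtain ⟨n, hn⟩ := mem_iUnion.1 hp
    obtain ⟨h₁, h₂⟩ := (hI n).2.1 p hn
    exact ⟨mem_iUnion.2 ⟨n, h₁⟩, h₂⟩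
  · refine iUnion_subset fun n x hx => ?_
    obtain ⟨p, hp, hxp⟩ := mem_iUnion₂.1 ((hI n).2.2 hx)
    exact mem_iUnion₂.2 ⟨p, mem_iUnion.2 ⟨n, hp⟩, hxp⟩

theorem preH_iUnion_eq_zero {Y : Type*} [MetricSpace Y] {g : Y × ℝ → ℝ≥0∞} {δ : ℝ}
    {F : ℕ → Set Y} (hF : ∀ n, preH g δ (F n) = 0) :
    preH g δ (⋃ n, F n) = 0 := by
  refine nonpos_iff_eq_zero.1 (le_of_forall_gt fun ε hε => ?_)
  obtain ⟨ε', hε', hsum⟩ := ENNReal.exists_pos_sum_of_countable' hε.ne' ℕ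
  have hcov : ∀ n, ∃ I, IsCenteredCover (F n) δ I ∧ ∑' p : I, g (p : Y × ℝ) < ε' n := by
    intro n
    have h : preH g δ (F n) < ε' n := by
      rw [hF n]
      exact hε' n
    simpa only [preH, iInf_lt_iff, exists_prop] using h
  choose I hI hIsum using hcov
  calc preH g δ (⋃ n, F n) ≤ ∑' p : ⋃ n, I n, g (p : Y × ℝ) :=
        iInf₂_le _ (IsCenteredCover.iUnion hI)
    _ ≤ ∑' n, ∑' p : I n, g (p : Y × ℝ) := ENNReal.tsum_iUnion_le_tsum _ _
    _ ≤ ∑' n, ε' n := ENNReal.tsum_le_tsum fun n => (hIsum n).le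
    _ < ε := hsum

/-- If the upper density of `θ` with respect to a doubling gauge exceeds `c` on `F`, the
pre-measure of `F` is controlled by the measure of any open neighbourhood of `F`. -/
theorem preH_le_of_frequently_lt_div [SecondCountableTopology X] [OpensMeasurableSpace X]
    {g : X × ℝ → ℝ≥0∞} (θ : Measure X) [IsFiniteMeasure θ] {F U : Set X}
    (hU : IsOpen U) (hFU : F ⊆ U) {c C : ℝ≥0∞} (hc : c ≠ 0)
    (hg : ∀ᶠ r in 𝓝[>] (0 : ℝ), ∀ x ∈ F, g (x, 5 * r) ≤ C * g (x, r))
    (hθ : ∀ x ∈ F, ∃ᶠ r in 𝓝[>] (0 : ℝ), c < θ (closedBall x r) / g (x, r))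
    {δ : ℝ} (hδ : 0 < δ) :
    preH g δ F ≤ C * (θ U / c) := by
  have hex : ∀ x : X, ∃ r : ℝ, x ∈ F → 0 < r ∧ 5 * r < δ ∧ closedBall x r ⊆ U ∧
      g (x, 5 * r) ≤ C * g (x, r) ∧ c < θ (closedBall x r) / g (x, r) := by
    intro x
    by_cases hx : x ∈ F
    · obtain ⟨s, hs, hsU⟩ := Metric.nhds_basis_closedBall.mem_iff.1 (hU.mem_nhds (hFU hx))
      have hsmall : ∀ᶠ r in 𝓝[>] (0 : ℝ), r ∈ Ioo 0 (min (δ / 5) s) :=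
        Ioo_mem_nhdsGT (lt_min (by positivity) hs)
      obtain ⟨r, hr, hr', hgr⟩ := ((hθ x hx).and_eventually (hsmall.and hg)).exists
      refine ⟨r, fun _ => ⟨hr'.1, ?_, ?_, hgr x hx, hr⟩⟩
      · have := hr'.2.trans_le (min_le_left _ _)
        linarith
      · exact (closedBall_subset_closedBall (hr'.2.trans_le (min_le_right _ _)).le).trans hsU
    · exact ⟨0, fun h => absurd h hx⟩
  choose r hr using hex
  obtain ⟨u, huF, hdisj, hcov⟩ := Vitali.exists_disjoint_subfamily_covering_enlargement_closedBall
    F id r δ (fun x hx => by linarith [(hr x hx).1, (hr x hx).2.1]) 5 (by norm_num)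
  simp only [id_eq] at hdisj hcov
  have hucount : u.Countable := hdisj.countable_of_nonempty_interior fun x hx =>
    ⟨x, ball_subset_interior_closedBall (mem_ball_self (hr x (huF hx)).1)⟩
  have hcover : IsCenteredCover F δ ((fun x => (x, 5 * r x)) '' u) := by
    refine ⟨hucount.image _, ?_, ?_⟩
    · rintro _ ⟨x, hx, rfl⟩
      have h := hr x (huF hx)
      exact ⟨huF hx, by linarith [h.1], h.2.1⟩
    · intro x hx
      obtain ⟨y, hy, hxy⟩ := hcov x hx
      exact mem_iUnion₂.2 ⟨_, mem_image_of_mem _ hy, hxy (mem_closedBall_self (hr x hx).1.le)⟩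
  have hinj : InjOn (fun x => (x, 5 * r x)) u := fun x _ y _ h => (Prod.ext_iff.1 h).1
  have hball : ∀ x ∈ u, g (x, r x) ≤ θ (closedBall x (r x)) / c := by
    intro x hx
    rw [ENNReal.le_div_iff_mul_le (Or.inl hc) (Or.inr (measure_ne_top _ _)), mul_comm]
    exact ENNReal.mul_le_of_le_div (hr x (huF hx)).2.2.2.2.le
  calc preH g δ F ≤ ∑' p : (fun x => (x, 5 * r x)) '' u, g (p : X × ℝ) := iInf₂_le _ hcover
    _ = ∑' x : u, g ((x : X), 5 * r x) := tsum_image _ hinj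
    _ ≤ ∑' x : u, C * (θ (closedBall (x : X) (r x)) / c) :=
        ENNReal.tsum_le_tsum fun x => (hr x (huF x.2)).2.2.2.1.trans
          (mul_le_mul_right (hball x x.2) C)
    _ = C * ((∑' x : u, θ (closedBall (x : X) (r x))) / c) := by
        simp only [div_eq_mul_inv, ENNReal.tsum_mul_left, ENNReal.tsum_mul_right]
    _ = C * (θ (⋃ x ∈ u, closedBall x (r x)) / c) := by
        rw [← measure_biUnion hucount hdisj fun x _ => isClosed_closedBall.measurableSet]
    _ ≤ C * (θ U / c) := by
        gcongr
        exact iUnion₂_subset fun x hx => (hr x (huF hx)).2.2.1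

theorem IsDoubling.eventually_measure_closedBall_le {σ : Measure X} [IsFiniteMeasure σ]
    (hσ : IsDoubling σ) (b : ℝ) :
    ∃ C : ℝ≥0∞, C ≠ ⊤ ∧ ∀ᶠ r in 𝓝[>] (0 : ℝ), ∀ x ∈ msupport σ,
      σ (closedBall x (b * r)) ≤ C * σ (closedBall x r) := by
  obtain ⟨a, ha, hlim⟩ := hσ
  obtain ⟨M, hM, hMtop⟩ := exists_between hlim
  have hstep : ∀ᶠ r in 𝓝[>] (0 : ℝ), ∀ x ∈ msupport σ,
      σ (closedBall x (a * r)) ≤ M * σ (closedBall x r) := by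
    filter_upwards [eventually_lt_of_limsup_lt hM, self_mem_nhdsWithin] with r hr hr0 x hx
    rw [← ENNReal.div_le_iff (hx r hr0).ne' (measure_ne_top _ _)]
    exact (le_iSup₂ (f := fun x (_ : x ∈ msupport σ) =>
      σ (closedBall x (a * r)) / σ (closedBall x r)) x hx).trans hr.le
  have hiter : ∀ n : ℕ, ∀ᶠ r in 𝓝[>] (0 : ℝ), ∀ x ∈ msupport σ,
      σ (closedBall x (a ^ n * r)) ≤ M ^ n * σ (closedBall x r) := by
    intro n
    induction n with
    | zero => simp
    | succ n ih =>
      have hscale : Tendsto (fun r : ℝ => a ^ n * r) (𝓝[>] 0) (𝓝[>] 0) := by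
        refine tendsto_nhdsWithin_iff.2 ⟨?_, ?_⟩
        · have h : Tendsto (fun r : ℝ => a ^ n * r) (𝓝 0) (𝓝 (a ^ n * 0)) :=
            (continuous_const_mul _).tendsto 0
          rw [mul_zero] at h
          exact h.mono_left nhdsWithin_le_nhds
        · filter_upwards [self_mem_nhdsWithin] with r hr
          exact mul_pos (pow_pos (zero_lt_one.trans ha) n) hr
      filter_upwards [ih, hscale.eventually hstep] with r h₁ h₂ x hx
      calc σ (closedBall x (a ^ (n + 1) * r)) = σ (closedBall x (a * (a ^ n * r))) := by
            rw [pow_succ', mul_assoc]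
        _ ≤ M * σ (closedBall x (a ^ n * r)) := h₂ x hx
        _ ≤ M * (M ^ n * σ (closedBall x r)) := mul_le_mul_right (h₁ x hx) M
        _ = M ^ (n + 1) * σ (closedBall x r) := by rw [pow_succ', mul_assoc]
  obtain ⟨n, hn⟩ := pow_unbounded_of_one_lt b ha
  refine ⟨M ^ n, ENNReal.pow_ne_top hMtop.ne, ?_⟩
  filter_upwards [hiter n, self_mem_nhdsWithin] with r hr hr0 x hx
  exact (measure_mono (closedBall_subset_closedBall
    (mul_le_mul_of_nonneg_right hn.le (le_of_lt hr0)))).trans (hr x hx)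

theorem IsDoubling.eventually_rpow_measure_closedBall_le {σ : Measure X} [IsFiniteMeasure σ]
    (hσ : IsDoubling σ) {b : ℝ} (hb : 1 ≤ b) (s : ℝ) :
    ∃ C : ℝ≥0∞, C ≠ ⊤ ∧ ∀ᶠ r in 𝓝[>] (0 : ℝ), ∀ x ∈ msupport σ,
      σ (closedBall x (b * r)) ^ s ≤ C * σ (closedBall x r) ^ s := by
  rcases le_or_gt 0 s with hs | hs
  · obtain ⟨C, hC, h⟩ := hσ.eventually_measure_closedBall_le b
    refine ⟨C ^ s, ENNReal.rpow_ne_top_of_nonneg hs hC, ?_⟩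
    filter_upwards [h] with r hr x hx
    rw [← ENNReal.mul_rpow_of_nonneg _ _ hs]
    exact ENNReal.rpow_le_rpow (hr x hx) hs
  · refine ⟨1, ENNReal.one_ne_top, ?_⟩
    filter_upwards [self_mem_nhdsWithin] with r hr x _
    rw [one_mul]
    rw [← neg_neg s, ENNReal.rpow_neg, ENNReal.rpow_neg _ (-s), ENNReal.inv_le_inv]
    exact ENNReal.rpow_le_rpow (measure_mono (closedBall_subset_closedBall
      (le_mul_of_one_le_left (le_of_lt hr) hb))) (neg_nonneg.2 hs.le)

theorem eventually_mgauge_le {k : ℕ} {μ : Fin k → Measure X} {ν : Measure X}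
    [∀ j, IsFiniteMeasure (μ j)] [IsFiniteMeasure ν]
    (hμ : ∀ j, IsDoubling (μ j)) (hν : IsDoubling ν) (q : Fin k → ℝ) (t : ℝ)
    {b : ℝ} (hb : 1 ≤ b) :
    ∃ C : ℝ≥0∞, C ≠ ⊤ ∧ ∀ᶠ r in 𝓝[>] (0 : ℝ), ∀ x ∈ Smu μ ∩ msupport ν,
      mgauge μ q ν t (x, b * r) ≤ C * mgauge μ q ν t (x, r) := by
  choose C hC hCμ using fun j => (hμ j).eventually_rpow_measure_closedBall_le hb (q j)
  obtain ⟨D, hD, hDν⟩ := hν.eventually_rpow_measure_closedBall_le hb t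
  refine ⟨(∏ j, C j) * D, ENNReal.mul_ne_top (ENNReal.prod_ne_top fun j _ => hC j) hD, ?_⟩
  filter_upwards [eventually_all.2 hCμ, hDν] with r h₁ h₂ x hx
  calc mgauge μ q ν t (x, b * r)
      ≤ (∏ j, C j * μ j (closedBall x r) ^ q j) * (D * ν (closedBall x r) ^ t) :=
        mul_le_mul' (Finset.prod_le_prod' fun j _ => h₁ j x (mem_iInter.1 hx.1 j)) (h₂ x hx.2)
    _ = (∏ j, C j) * D * mgauge μ q ν t (x, r) := by
        rw [Finset.prod_mul_distrib, mul_mul_mul_comm]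
        rfl

/-- with doubling measures and `H^{q,t}_{μ,ν}(E) < ∞`, the upper
`(q,t)`-density of `λ_E = θ(· \ E)` vanishes `H^{q,t}_{μ,ν}`-a.e. on `E`. -/
theorem upperDensity_restrict_compl_ae_zero
    (d k : ℕ) (hd : 1 ≤ d) (hk : 1 ≤ k)
    (μ : Fin k → Measure (Rd d)) (ν : Measure (Rd d))
    (hμ : ∀ j, IsProbabilityMeasure (μ j)) (hν : IsProbabilityMeasure ν)
    (hμD : ∀ j, IsDoubling (μ j)) (hνD : IsDoubling ν)
    (q : Fin k → ℝ) (t : ℝ)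
    (E : Set (Rd d)) (hE : MeasurableSet E) (hES : E ⊆ Smu μ ∩ msupport ν)
    (hfin : mixedH (mgauge μ q ν t) E < ⊤)
    (θ : Measure (Rd d)) (hθ : IsProbabilityMeasure θ) :
    mixedH (mgauge μ q ν t)
      {x ∈ E | upperDensity μ q ν t (θ.restrict Eᶜ) x ≠ 0} = 0 := by
  obtain ⟨C, hC, hg⟩ := eventually_mgauge_le hμD hνD q t (b := 5) (by norm_num)
  refine nonpos_iff_eq_zero.1 (iSup₂_le fun F hF => iSup₂_le fun δ hδ => nonpos_iff_eq_zero.2 ?_)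
  set dens : Rd d → ℝ≥0∞ := upperDensity μ q ν t (θ.restrict Eᶜ)
  have hFunion : F = ⋃ n : ℕ, {x ∈ F | (n : ℝ≥0∞)⁻¹ < dens x} := by
    refine subset_antisymm (fun x hx => ?_) (iUnion_subset fun n => sep_subset _ _)
    obtain ⟨n, hn⟩ := ENNReal.exists_inv_nat_lt (hF hx).2
    exact mem_iUnion.2 ⟨n, hx, hn⟩
  rw [hFunion]
  refine preH_iUnion_eq_zero fun n => ?_
  have hc : (n : ℝ≥0∞)⁻¹ ≠ 0 := ENNReal.inv_ne_zero.2 (ENNReal.natCast_ne_top n)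
  have hnull : θ.restrict Eᶜ E = 0 := by
    rw [Measure.restrict_apply hE, inter_compl_self, measure_empty]
  have hle : ∀ η : ℝ≥0∞, η ≠ 0 →
      preH (mgauge μ q ν t) δ {x ∈ F | (n : ℝ≥0∞)⁻¹ < dens x} ≤ C * (η / (n : ℝ≥0∞)⁻¹) := by
    intro η hη
    obtain ⟨U, hEU, hU, hUη⟩ :=
      E.exists_isOpen_lt_of_lt η (hnull.trans_lt (pos_iff_ne_zero.2 hη))
    refine (preH_le_of_frequently_lt_div (θ.restrict Eᶜ) hU (fun x hx => hEU (hF hx.1).1) hc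
      (hg.mono fun r hr x hx => hr x (hES (hF hx.1).1))
      (fun x hx => frequently_lt_of_lt_limsup (by isBoundedDefault) hx.2) hδ).trans ?_
    gcongr
  by_contra hne
  obtain ⟨η, hη, hlt⟩ := ENNReal.exists_nnreal_pos_mul_lt
    (ENNReal.mul_ne_top hC (ENNReal.natCast_ne_top n)) hne
  refine (hle η (ENNReal.coe_ne_zero.2 hη.ne')).not_gt ?_
  rwa [div_eq_mul_inv, inv_inv, mul_left_comm]

end MixedMultifractal
end
end
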